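/- arXiv:1105.5499 — 3 statements merged into one kernel-verified Lean document; each statement's English description precedes it below -/
import Mathlib

section
/- Let 1 ≤ p < 2. There exists a constant C > 0 such that for all N, n ∈ ℕ with 1 ≤ n ≤ N/4, the n-th Kolmogorov number of the identity map from ℓ_p^N to ℓ_∞^N satisfies d_n(id : ℓ_p^N → ℓ_∞^N) ≤ C · n^{-1/2} · (log(eN/n))^{3/2}. -/
open scoped ENNReal BigOperators

/-- The ℓ_p quasi-norm on ℝ^N, for `p : ℝ≥0∞` (with `p = ∞` giving the sup-norm). -/
noncomputable def pNorm (p : ℝ≥0∞) {N : ℕ} (x : Fin N → ℝ) : ℝ :=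
  if p = ∞ then ⨆ i, |x i| else (∑ i, |x i| ^ p.toReal) ^ (1 / p.toReal)

/-- The n-th Kolmogorov number of the identity map `id : ℓ_p^N → ℓ_q^N`. -/
noncomputable def kolmogorovNumber (p q : ℝ≥0∞) (N n : ℕ) : ℝ :=
  sInf { r : ℝ | ∃ V : Submodule ℝ (Fin N → ℝ), Module.finrank ℝ (↥V) < n ∧
    r = sSup { s : ℝ | ∃ x : Fin N → ℝ, pNorm p x ≤ 1 ∧
      s = sInf { t : ℝ | ∃ v ∈ V, t = pNorm q (x - v) } } }

/-- The n-th Gelfand number of the identity map `id : ℓ_p^N → ℓ_q^N`. -/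
noncomputable def gelfandNumber (p q : ℝ≥0∞) (N n : ℕ) : ℝ :=
  sInf { r : ℝ | ∃ M : Submodule ℝ (Fin N → ℝ), N - Module.finrank ℝ (↥M) < n ∧
    r = sSup { s : ℝ | ∃ x ∈ M, pNorm p x ≤ 1 ∧ s = pNorm q x } }

/-- The n-th approximation number of the identity map `id : ℓ_p^N → ℓ_q^N`. -/
noncomputable def approxNumber (p q : ℝ≥0∞) (N n : ℕ) : ℝ :=
  sInf { r : ℝ | ∃ L : (Fin N → ℝ) →ₗ[ℝ] (Fin N → ℝ),
    Module.finrank ℝ (↥(LinearMap.range L)) < n ∧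
    r = sSup { s : ℝ | ∃ x : Fin N → ℝ, pNorm p x ≤ 1 ∧ s = pNorm q (x - L x) } }

/-- The real sign attached to a Boolean. -/
def boolSign (b : Bool) : ℝ := if b then 1 else -1

lemma boolSign_sq (b : Bool) : boolSign b ^ 2 = 1 := by
  cases b <;> simp [boolSign]

lemma sum_fin_succ_bool {n : ℕ} (f : (Fin (n + 1) → Bool) → ℝ) :
    ∑ e, f e = ∑ e : Fin n → Bool, (f (Fin.cons true e) + f (Fin.cons false e)) := by
  rw [← (Fin.consEquiv (fun _ : Fin (n + 1) => Bool)).sum_comp, Fintype.sum_prod_type_right]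
  simp [Fin.consEquiv]

lemma sum_rademacher_sq {N : ℕ} (y : Fin N → ℝ) :
    ∑ e : Fin N → Bool, (∑ i, boolSign (e i) * y i) ^ 2 = 2 ^ N * ∑ i, y i ^ 2 := by
  induction N with
  | zero => simp
  | succ n ih =>
    rw [sum_fin_succ_bool]
    have h : ∀ e : Fin n → Bool,
        (∑ i, boolSign ((Fin.cons true e : Fin (n + 1) → Bool) i) * y i) ^ 2 +
        (∑ i, boolSign ((Fin.cons false e : Fin (n + 1) → Bool) i) * y i) ^ 2 =
        2 * (∑ i, boolSign (e i) * y i.succ) ^ 2 + 2 * y 0 ^ 2 := by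
      intro e
      simp only [Fin.sum_univ_succ, Fin.cons_zero, Fin.cons_succ, boolSign]
      simp only [if_true, Bool.false_eq_true, if_false]
      ring
    rw [Finset.sum_congr rfl fun e _ => h e, Finset.sum_add_distrib, ← Finset.mul_sum,
      ih fun i => y i.succ, Fin.sum_univ_succ]
    simp
    ring

lemma sum_rademacher_pow_four_le {N : ℕ} (y : Fin N → ℝ) :
    ∑ e : Fin N → Bool, (∑ i, boolSign (e i) * y i) ^ 4 ≤ 3 * 2 ^ N * (∑ i, y i ^ 2) ^ 2 := by
  induction N with
  | zero => simp
  | succ n ih =>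
    rw [sum_fin_succ_bool]
    have h : ∀ e : Fin n → Bool,
        (∑ i, boolSign ((Fin.cons true e : Fin (n + 1) → Bool) i) * y i) ^ 4 +
        (∑ i, boolSign ((Fin.cons false e : Fin (n + 1) → Bool) i) * y i) ^ 4 =
        2 * (∑ i, boolSign (e i) * y i.succ) ^ 4 +
          12 * y 0 ^ 2 * (∑ i, boolSign (e i) * y i.succ) ^ 2 + 2 * y 0 ^ 4 := by
      intro e
      simp only [Fin.sum_univ_succ, Fin.cons_zero, Fin.cons_succ, boolSign]
      simp only [if_true, Bool.false_eq_true, if_false]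
      ring
    rw [Finset.sum_congr rfl fun e _ => h e, Finset.sum_add_distrib, Finset.sum_add_distrib,
      ← Finset.mul_sum, ← Finset.mul_sum, sum_rademacher_sq fun i => y i.succ, Fin.sum_univ_succ]
    have h1 := ih fun i => y i.succ
    simp only [Finset.sum_const, Finset.card_univ, Fintype.card_fun, Fintype.card_bool,
      Fintype.card_fin, nsmul_eq_mul, Nat.cast_pow, Nat.cast_ofNat]
    have h2 : (0 : ℝ) ≤ 2 ^ n * y 0 ^ 4 := by positivity
    rw [pow_succ (2 : ℝ) n]
    nlinarith

lemma exp_neg_le_quadratic {u : ℝ} (hu : 0 ≤ u) : Real.exp (-u) ≤ 1 - u + u ^ 2 / 2 := by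
  have h := Real.quadratic_le_exp_of_nonneg hu
  rw [Real.exp_neg, inv_le_iff_one_le_mul₀ (Real.exp_pos u)]
  have h1 : 0 ≤ 1 - u + u ^ 2 / 2 := by nlinarith [sq_nonneg (u - 1)]
  calc (1 : ℝ) ≤ (1 - u + u ^ 2 / 2) * (1 + u + u ^ 2 / 2) := by nlinarith [sq_nonneg (u ^ 2)]
    _ ≤ _ := mul_le_mul_of_nonneg_left h h1

lemma sum_exp_neg_rademacher_sq_le {N : ℕ} (y : Fin N → ℝ) (hy : 0 < ∑ i, y i ^ 2) :
    ∑ e : Fin N → Bool, Real.exp (-((∑ i, boolSign (e i) * y i) ^ 2 / (3 * ∑ i, y i ^ 2))) ≤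
      2 ^ N * Real.exp (-(1 / 6)) := by
  set σ := ∑ i, y i ^ 2 with hσ
  have h1 : (5 / 6 : ℝ) ≤ Real.exp (-(1 / 6)) := by
    have := Real.add_one_le_exp (-(1 / 6) : ℝ)
    linarith
  calc _ ≤ ∑ e : Fin N → Bool, (1 - (1 / (3 * σ)) * (∑ i, boolSign (e i) * y i) ^ 2 +
          (1 / (18 * σ ^ 2)) * (∑ i, boolSign (e i) * y i) ^ 4) := by
        refine Finset.sum_le_sum fun e _ => ?_
        refine (exp_neg_le_quadratic (by positivity)).trans (le_of_eq ?_)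
        field_simp
        ring
    _ = 2 ^ N - (1 / (3 * σ)) * (2 ^ N * σ) + (1 / (18 * σ ^ 2)) *
          ∑ e : Fin N → Bool, (∑ i, boolSign (e i) * y i) ^ 4 := by
        rw [Finset.sum_add_distrib, Finset.sum_sub_distrib, ← Finset.mul_sum, ← Finset.mul_sum,
          sum_rademacher_sq, ← hσ]
        simp
    _ ≤ 2 ^ N - (1 / (3 * σ)) * (2 ^ N * σ) + (1 / (18 * σ ^ 2)) * (3 * 2 ^ N * σ ^ 2) := by
        gcongr
        exact sum_rademacher_pow_four_le y
    _ = 2 ^ N * (5 / 6) := by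
        field_simp
        ring
    _ ≤ _ := by gcongr

lemma card_sign_matrix_small_le {N : ℕ} (m : ℕ) (y : Fin N → ℝ) :
    ((Finset.univ.filter fun A : Fin m → Fin N → Bool =>
      ∑ r, (∑ i, boolSign (A r i) * y i) ^ 2 < m / 16 * ∑ i, y i ^ 2).card : ℝ) ≤
      (2 ^ N) ^ m * Real.exp (-(m / 8)) := by
  rcases (Finset.sum_nonneg fun i _ => sq_nonneg (y i) :
    0 ≤ ∑ i, y i ^ 2).eq_or_lt with h0 | hy
  · rw [← h0, Finset.filter_false_of_mem]
    · simp only [Finset.card_empty, Nat.cast_zero]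
      positivity
    · intro A _
      rw [mul_zero, not_lt]
      positivity
  set σ := ∑ i, y i ^ 2 with hσ
  set B := Finset.univ.filter fun A : Fin m → Fin N → Bool =>
      ∑ r, (∑ i, boolSign (A r i) * y i) ^ 2 < m / 16 * σ with hB
  have key : (B.card : ℝ) * Real.exp (-(m / 48)) ≤ (2 ^ N * Real.exp (-(1 / 6))) ^ m := by
    calc (B.card : ℝ) * Real.exp (-(m / 48)) = ∑ A ∈ B, Real.exp (-(m / 48)) := by simp
      _ ≤ ∑ A ∈ B, ∏ r, Real.exp (-((∑ i, boolSign (A r i) * y i) ^ 2 / (3 * σ))) := by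
          refine Finset.sum_le_sum fun A hA => ?_
          rw [← Real.exp_sum, Finset.sum_neg_distrib, ← Finset.sum_div]
          refine Real.exp_le_exp.2 (neg_le_neg ?_)
          rw [div_le_iff₀ (by positivity)]
          have := (Finset.mem_filter.1 hA).2
          nlinarith
      _ ≤ ∑ A : Fin m → Fin N → Bool,
            ∏ r, Real.exp (-((∑ i, boolSign (A r i) * y i) ^ 2 / (3 * σ))) :=
          Finset.sum_le_sum_of_subset_of_nonneg (Finset.subset_univ _) fun _ _ _ => by positivity
      _ = (∑ e : Fin N → Bool,
            Real.exp (-((∑ i, boolSign (e i) * y i) ^ 2 / (3 * σ)))) ^ m :=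
          (Fintype.sum_pow (fun e : Fin N → Bool =>
            Real.exp (-((∑ i, boolSign (e i) * y i) ^ 2 / (3 * σ)))) m).symm
      _ ≤ _ := pow_le_pow_left₀ (Finset.sum_nonneg fun _ _ => by positivity)
          (sum_exp_neg_rademacher_sq_le y hy) m
  rw [mul_pow, ← Real.exp_nat_mul] at key
  have h2 : (B.card : ℝ) ≤ (2 ^ N) ^ m * Real.exp (m * -(1 / 6)) * Real.exp (m / 48) := by
    rw [Real.exp_neg, ← div_eq_mul_inv, div_le_iff₀ (Real.exp_pos _)] at key
    exact key
  refine h2.trans ?_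
  rw [mul_assoc, ← Real.exp_add]
  gcongr
  have : (0 : ℝ) ≤ m := by positivity
  linarith

lemma exists_sign_matrix_lower_bound {N m : ℕ} {S : Type*} [Fintype S] (Y : S → Fin N → ℝ)
    (hS : (Fintype.card S : ℝ) * Real.exp (-(m / 8)) < 1) :
    ∃ A : Fin m → Fin N → Bool, ∀ s,
      m / 16 * ∑ i, Y s i ^ 2 ≤ ∑ r, (∑ i, boolSign (A r i) * Y s i) ^ 2 := by
  classical
  by_contra! h
  have hsub : (Finset.univ : Finset (Fin m → Fin N → Bool)) ⊆ Finset.univ.biUnion fun s : S =>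
      Finset.univ.filter fun A : Fin m → Fin N → Bool =>
        ∑ r, (∑ i, boolSign (A r i) * Y s i) ^ 2 < m / 16 * ∑ i, Y s i ^ 2 := by
    intro A _
    obtain ⟨s, hs⟩ := h A
    exact Finset.mem_biUnion.2 ⟨s, Finset.mem_univ _, Finset.mem_filter.2 ⟨Finset.mem_univ _, hs⟩⟩
  have h1 : ((2 : ℝ) ^ N) ^ m ≤ Fintype.card S * ((2 ^ N) ^ m * Real.exp (-(m / 8))) := by
    have h2 := (Finset.card_le_card hsub).trans Finset.card_biUnion_le
    have h3 : (Finset.univ : Finset (Fin m → Fin N → Bool)).card = (2 ^ N) ^ m := by simp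
    rw [h3] at h2
    calc ((2 : ℝ) ^ N) ^ m = (((2 ^ N) ^ m : ℕ) : ℝ) := by push_cast; rfl
      _ ≤ _ := Nat.cast_le.2 h2
      _ ≤ ∑ s : S, ((2 : ℝ) ^ N) ^ m * Real.exp (-(m / 8)) := by
        push_cast
        exact Finset.sum_le_sum fun s _ => card_sign_matrix_small_le m (Y s)
      _ = _ := by simp
  have h4 : (0 : ℝ) < (2 ^ N) ^ m := by positivity
  nlinarith

/-- Maurey's empirical method, stated for multisets of indices. -/
lemma exists_sym_sum_sq_sub_le {J ι : Type*} [Fintype J] [Fintype ι] (T : J → ι → ℝ) {R : ℝ}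
    (hR : ∀ j, ∑ i, T j i ^ 2 ≤ R) {w : J → ℝ} (hw : ∀ j, 0 ≤ w j) (hw1 : ∑ j, w j = 1) (k : ℕ) :
    ∃ s : Sym J k,
      ∑ i, ((s.1.map fun j => T j i).sum - k * ∑ j, w j * T j i) ^ 2 ≤ k * R := by
  induction k with
  | zero => exact ⟨Sym.nil, by simp⟩
  | succ k ih =>
    obtain ⟨s, hs⟩ := ih
    set x : ι → ℝ := fun i => ∑ j, w j * T j i with hx
    set W : ι → ℝ := fun i => (s.1.map fun j => T j i).sum - k * x i with hW
    have havg : ∑ j, w j * ∑ i, (W i + T j i - x i) ^ 2 ≤ ∑ j, w j * ((k + 1) * R) := by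
      have h1 : ∑ j, w j * ∑ i, (W i + T j i - x i) ^ 2 =
          ∑ i, W i ^ 2 + ∑ j, w j * ∑ i, T j i ^ 2 - ∑ i, x i ^ 2 := by
        have h2 : ∀ i, ∑ j, w j * (W i + T j i - x i) ^ 2 =
            W i ^ 2 + ∑ j, w j * T j i ^ 2 - x i ^ 2 := by
          intro i
          have h3 : ∀ j, w j * (W i + T j i - x i) ^ 2 =
              w j * (W i - x i) ^ 2 + w j * T j i * (2 * (W i - x i)) + w j * T j i ^ 2 := by
            intro j
            ring
          rw [Finset.sum_congr rfl fun j _ => h3 j, Finset.sum_add_distrib,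
            Finset.sum_add_distrib, ← Finset.sum_mul, ← Finset.sum_mul, hw1]
          change 1 * (W i - x i) ^ 2 + x i * _ + _ = _
          ring
        simp_rw [Finset.mul_sum]
        rw [Finset.sum_comm, Finset.sum_congr rfl fun i _ => h2 i, Finset.sum_sub_distrib,
          Finset.sum_add_distrib, Finset.sum_comm (f := fun i j => w j * T j i ^ 2)]
      have h4 : ∑ j, w j * ∑ i, T j i ^ 2 ≤ R := by
        calc _ ≤ ∑ j, w j * R :=
              Finset.sum_le_sum fun j _ => mul_le_mul_of_nonneg_left (hR j) (hw j)
          _ = R := by rw [← Finset.sum_mul, hw1, one_mul]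
      have h5 : 0 ≤ ∑ i, x i ^ 2 := Finset.sum_nonneg fun i _ => sq_nonneg _
      rw [h1, ← Finset.sum_mul, hw1]
      linarith
    have hex : ∃ j, ∑ i, (W i + T j i - x i) ^ 2 ≤ (k + 1) * R := by
      by_contra! hcon
      refine absurd havg (not_le.2 ?_)
      obtain ⟨j, -, hj⟩ : ∃ j ∈ Finset.univ, 0 < w j := by
        apply Finset.exists_lt_of_sum_lt
        simp [hw1]
      exact Finset.sum_lt_sum (fun j _ => mul_le_mul_of_nonneg_left (hcon j).le (hw j))
        ⟨j, Finset.mem_univ _, mul_lt_mul_of_pos_left (hcon j) hj⟩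
    obtain ⟨j, hj⟩ := hex
    refine ⟨j ::ₛ s, ?_⟩
    push_cast
    refine le_trans (le_of_eq ?_) hj
    refine Finset.sum_congr rfl fun i _ => ?_
    congr 1
    have : ((j ::ₛ s : Sym J (k + 1)).1.map fun j => T j i).sum
        = T j i + (s.1.map fun j => T j i).sum := by
      change (Multiset.map _ (j ::ₘ s.1)).sum = _
      rw [Multiset.map_cons, Multiset.sum_cons]
    rw [this]
    simp only [hW]
    ring

/-- The sum of the signed unit vectors listed by a multiset. -/
def signedSum {N : ℕ} (s : Multiset (Fin N × Bool)) (i : Fin N) : ℝ :=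
  (s.map fun q => boolSign q.2 * if q.1 = i then 1 else 0).sum

lemma sum_mul_signedSum {N : ℕ} (a : Fin N → ℝ) (s : Multiset (Fin N × Bool)) :
    ∑ i, a i * signedSum s i = (s.map fun q => boolSign q.2 * a q.1).sum := by
  induction s using Multiset.induction_on with
  | empty => simp [signedSum]
  | cons q s ih =>
    have h : ∀ i, signedSum (q ::ₘ s) i =
        (boolSign q.2 * if q.1 = i then 1 else 0) + signedSum s i := by
      intro i
      simp [signedSum]
    simp only [h, mul_add, Finset.sum_add_distrib, ih, Multiset.map_cons, Multiset.sum_cons]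
    congr 1
    simp [mul_comm]

lemma sum_sq_le_of_sign_matrix_kernel {N m k : ℕ} (hm : 0 < m) (hk : 0 < k)
    {A : Fin m → Fin N → Bool}
    (hA : ∀ s : Sym (Fin N × Bool) k, m / 16 * ∑ i, signedSum s.1 i ^ 2 ≤
      ∑ r, (∑ i, boolSign (A r i) * signedSum s.1 i) ^ 2)
    {x : Fin N → ℝ} (hx1 : ∑ i, |x i| = 1) (hx : ∀ r, ∑ i, boolSign (A r i) * x i = 0) :
    ∑ i, x i ^ 2 ≤ 68 / k := by
  have hm' : (0 : ℝ) < m := by exact_mod_cast hm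
  have hk' : (0 : ℝ) < k := by exact_mod_cast hk
  set w : Fin N × Bool → ℝ := fun q => (|x q.1| + boolSign q.2 * x q.1) / 2 with hw
  have hw0 : ∀ q, 0 ≤ w q := by
    rintro ⟨j, b⟩
    have h1 := neg_abs_le (x j)
    have h2 := le_abs_self (x j)
    cases b <;> simp [hw, boolSign] <;> linarith
  have hwsum : ∑ q, w q = 1 := by
    rw [Fintype.sum_prod_type, ← hx1]
    refine Finset.sum_congr rfl fun j _ => ?_
    simp [hw, boolSign]
    ring
  have hwlin : ∀ a : Fin N → ℝ, ∑ q, w q * (boolSign q.2 * a q.1) = ∑ i, a i * x i := by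
    intro a
    rw [Fintype.sum_prod_type]
    refine Finset.sum_congr rfl fun j _ => ?_
    simp [hw, boolSign]
    ring
  set T : Fin N × Bool → Fin N ⊕ Fin m → ℝ := fun q => Sum.elim
    (fun i => boolSign q.2 * if q.1 = i then 1 else 0)
    (fun r => boolSign q.2 * (boolSign (A r q.1) / √m)) with hT
  have hsq : (√(m : ℝ)) ^ 2 = m := Real.sq_sqrt hm'.le
  have hTR : ∀ q, ∑ i, T q i ^ 2 ≤ 2 := by
    intro q
    simp only [hT, Fintype.sum_sum_type, Sum.elim_inl, Sum.elim_inr, mul_pow, div_pow,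
      boolSign_sq, hsq]
    simp [hm'.ne']
    norm_num
  obtain ⟨s, hs⟩ := exists_sym_sum_sq_sub_le T hTR hw0 hwsum k
  simp only [hT, Fintype.sum_sum_type, Sum.elim_inl, Sum.elim_inr] at hs
  have e1 : ∀ i, ∑ q, w q * (boolSign q.2 * if q.1 = i then (1 : ℝ) else 0) = x i := by
    intro i
    rw [hwlin fun j => if j = i then (1 : ℝ) else 0]
    simp
  have e2 : ∀ r, ∑ q, w q * (boolSign q.2 * (boolSign (A r q.1) / √m)) = 0 := by
    intro r
    rw [hwlin fun j => boolSign (A r j) / √m]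
    simp_rw [div_mul_eq_mul_div]
    rw [← Finset.sum_div, hx r, zero_div]
  have e3 : ∀ r, (s.1.map fun q => boolSign q.2 * (boolSign (A r q.1) / √m)).sum =
      (∑ i, boolSign (A r i) * signedSum s.1 i) / √m := by
    intro r
    rw [← sum_mul_signedSum fun j => boolSign (A r j) / √m, Finset.sum_div]
    exact Finset.sum_congr rfl fun i _ => by ring
  simp only [e1, e2, e3, mul_zero, sub_zero, div_pow, hsq, ← Finset.sum_div] at hs
  change ∑ i, (signedSum s.1 i - k * x i) ^ 2 + _ ≤ _ at hs
  have h1 := hA s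
  have h2 : ∑ i, signedSum s.1 i ^ 2 ≤
      16 * ((∑ r, (∑ i, boolSign (A r i) * signedSum s.1 i) ^ 2) / m) := by
    rw [← mul_div_assoc, le_div_iff₀ hm']
    linarith
  have h3 : k ^ 2 * ∑ i, x i ^ 2 ≤
      2 * ∑ i, signedSum s.1 i ^ 2 + 2 * ∑ i, (signedSum s.1 i - k * x i) ^ 2 := by
    rw [Finset.mul_sum, Finset.mul_sum, Finset.mul_sum, ← Finset.sum_add_distrib]
    refine Finset.sum_le_sum fun i _ => ?_
    nlinarith [sq_nonneg (2 * signedSum s.1 i - k * x i)]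
  have h4 : 0 ≤ ∑ i, (signedSum s.1 i - k * x i) ^ 2 := Finset.sum_nonneg fun i _ => sq_nonneg _
  rw [le_div_iff₀ hk']
  have h5 : k ^ 2 * ∑ i, x i ^ 2 ≤ 68 * k := by linarith
  have h6 : k * ((∑ i, x i ^ 2) * k) ≤ k * 68 := by nlinarith
  exact le_of_mul_le_mul_left h6 hk'

lemma exists_mem_span_abs_sub_le {N m : ℕ} (a : Fin m → Fin N → ℝ) (y : Fin N → ℝ) {ε : ℝ}
    (hε : 0 ≤ ε)
    (h : ∀ x : Fin N → ℝ, (∀ r, ∑ i, a r i * x i = 0) → ∑ i, y i * x i ≤ ε * ∑ i, |x i|) :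
    ∃ v ∈ Submodule.span ℝ (Set.range a), ∀ i, |y i - v i| ≤ ε := by
  classical
  let L : (Fin N → ℝ) →ₗ[ℝ] (Fin N → ℝ) →ₗ[ℝ] ℝ := dotProductBilin ℝ ℝ
  have hL : ∀ u x, L u x = ∑ i, u i * x i := fun u x => rfl
  let E : Submodule ℝ (Fin N → ℝ) := ⨅ r, LinearMap.ker (L (a r))
  have hE : ∀ x ∈ E, ∀ r, ∑ i, a r i * x i = 0 := by
    intro x hx r
    exact (Submodule.mem_iInf _).1 hx r
  obtain ⟨g, hg, hgle⟩ := exists_extension_of_le_sublinear ⟨E, (L y).comp E.subtype⟩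
    (fun x => ε * ∑ i, |x i|)
    (fun c hc x => by
      simp only [Pi.smul_apply, smul_eq_mul, abs_mul, abs_of_pos hc, ← Finset.mul_sum]
      ring)
    (fun x z => by
      rw [← mul_add, ← Finset.sum_add_distrib]
      exact mul_le_mul_of_nonneg_left
        (Finset.sum_le_sum fun i _ => abs_add_le _ _) hε)
    (fun x => h x.1 (hE x.1 x.2))
  have hker : ⨅ r, LinearMap.ker (L (a r)) ≤ LinearMap.ker (L y - g) := by
    intro x hx
    have := hg ⟨x, hx⟩
    change g x = L y x at this
    simp [this]
  have hmem := mem_span_of_iInf_ker_le_ker hker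
  have hrange : Set.range (fun r => L (a r)) = L '' Set.range a := by
    rw [← Set.range_comp]
    rfl
  rw [hrange, ← Submodule.map_span] at hmem
  obtain ⟨v, hv, hveq⟩ := hmem
  refine ⟨v, hv, fun i => ?_⟩
  have hcoord : ∀ u : Fin N → ℝ, L u (Pi.single i 1) = u i := by
    intro u
    simp [hL, Pi.single_apply]
  have h1 : y i - v i = g (Pi.single i 1) := by
    have := LinearMap.congr_fun hveq (Pi.single i 1)
    rw [LinearMap.sub_apply, hcoord, hcoord] at this
    linarith
  have hn : ∑ j, |(Pi.single i 1 : Fin N → ℝ) j| = 1 := by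
    simp [Pi.single_apply, apply_ite abs]
  have h2 := hgle (Pi.single i 1)
  have h3 := hgle (-Pi.single i 1)
  simp only [Pi.neg_apply, abs_neg, map_neg, hn] at h2 h3
  rw [h1, abs_le]
  constructor <;> linarith

lemma sum_sq_le_one_of_pNorm_le_one {p : ℝ} (hp1 : 1 ≤ p) (hp2 : p < 2) {N : ℕ}
    {y : Fin N → ℝ} (hy : pNorm (ENNReal.ofReal p) y ≤ 1) : ∑ i, y i ^ 2 ≤ 1 := by
  have hp : 0 < p := by linarith
  rw [pNorm, if_neg ENNReal.ofReal_ne_top, ENNReal.toReal_ofReal hp.le] at hy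
  have h0 : 0 ≤ ∑ i, |y i| ^ p := Finset.sum_nonneg fun i _ => by positivity
  have h1 : ∑ i, |y i| ^ p ≤ 1 := by
    by_contra! hcon
    exact absurd hy (not_le.2 (Real.one_lt_rpow hcon (by positivity)))
  refine le_trans (Finset.sum_le_sum fun i _ => ?_) h1
  have h2 : |y i| ^ p ≤ 1 :=
    (Finset.single_le_sum (f := fun i => |y i| ^ p) (fun i _ => by positivity)
      (Finset.mem_univ i)).trans h1
  have h3 : |y i| ≤ 1 := by
    by_contra! hcon
    exact absurd h2 (not_le.2 (Real.one_lt_rpow hcon hp))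
  rw [← sq_abs, ← Real.rpow_natCast]
  exact Real.rpow_le_rpow_of_exponent_ge_of_imp (abs_nonneg _) h3 (by push_cast; exact hp2.le)
    (fun _ h => absurd h (by norm_num))

lemma pNorm_top_nonneg {N : ℕ} (x : Fin N → ℝ) : 0 ≤ pNorm ∞ x := by
  rw [pNorm, if_pos rfl]
  exact Real.iSup_nonneg fun i => abs_nonneg _

lemma pNorm_top_le {N : ℕ} {x : Fin N → ℝ} {ε : ℝ} (hε : 0 ≤ ε) (h : ∀ i, |x i| ≤ ε) :
    pNorm ∞ x ≤ ε := by
  rw [pNorm, if_pos rfl]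
  exact Real.iSup_le h hε

lemma kolmogorovNumber_top_le {p : ℝ≥0∞} {N n : ℕ} (V : Submodule ℝ (Fin N → ℝ))
    (hV : Module.finrank ℝ V < n) {ε : ℝ} (hε : 0 ≤ ε)
    (h : ∀ y : Fin N → ℝ, pNorm p y ≤ 1 → ∃ v ∈ V, ∀ i, |y i - v i| ≤ ε) :
    kolmogorovNumber p ∞ N n ≤ ε := by
  have hbdd : BddBelow { r : ℝ | ∃ V : Submodule ℝ (Fin N → ℝ), Module.finrank ℝ (↥V) < n ∧
    r = sSup { s : ℝ | ∃ x : Fin N → ℝ, pNorm p x ≤ 1 ∧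
      s = sInf { t : ℝ | ∃ v ∈ V, t = pNorm ∞ (x - v) } } } := by
    refine ⟨0, ?_⟩
    rintro r ⟨V, -, rfl⟩
    refine Real.sSup_nonneg ?_
    rintro s ⟨x, -, rfl⟩
    refine Real.sInf_nonneg ?_
    rintro t ⟨v, -, rfl⟩
    exact pNorm_top_nonneg _
  refine (csInf_le hbdd ⟨V, hV, rfl⟩).trans (Real.sSup_le ?_ hε)
  rintro s ⟨y, hy, rfl⟩
  obtain ⟨v, hv, hle⟩ := h y hy
  have hbdd' : BddBelow { t : ℝ | ∃ v ∈ V, t = pNorm ∞ (y - v) } := by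
    refine ⟨0, ?_⟩
    rintro t ⟨v, -, rfl⟩
    exact pNorm_top_nonneg _
  exact (csInf_le hbdd' ⟨v, hv, rfl⟩).trans (pNorm_top_le hε hle)

lemma kolmogorovNumber_le_one {p : ℝ} (hp1 : 1 ≤ p) (hp2 : p < 2) {N n : ℕ} (hn : 1 ≤ n) :
    kolmogorovNumber (ENNReal.ofReal p) ∞ N n ≤ 1 := by
  refine kolmogorovNumber_top_le ⊥ (by rw [finrank_bot]; omega) zero_le_one fun y hy =>
    ⟨0, Submodule.zero_mem _, fun i => ?_⟩
  have h1 := sum_sq_le_one_of_pNorm_le_one hp1 hp2 hy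
  have h2 : y i ^ 2 ≤ ∑ i, y i ^ 2 :=
    Finset.single_le_sum (f := fun i => y i ^ 2) (fun i _ => sq_nonneg _) (Finset.mem_univ i)
  simpa using abs_le_one_iff_mul_self_le_one.2 (by nlinarith)

lemma kolmogorovNumber_le_sqrt {p : ℝ} (hp1 : 1 ≤ p) (hp2 : p < 2) {N n m k : ℕ} (hm : 0 < m)
    (hmn : m < n) (hk : 0 < k)
    (hcard : (Fintype.card (Sym (Fin N × Bool) k) : ℝ) * Real.exp (-(m / 8)) < 1) :
    kolmogorovNumber (ENNReal.ofReal p) ∞ N n ≤ √(68 / k) := by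
  obtain ⟨A, hA⟩ := exists_sign_matrix_lower_bound
    (fun s : Sym (Fin N × Bool) k => signedSum s.1) hcard
  set a : Fin m → Fin N → ℝ := fun r i => boolSign (A r i) with ha
  refine kolmogorovNumber_top_le (Submodule.span ℝ (Set.range a))
    (((finrank_range_le_card a).trans_eq (Fintype.card_fin m)).trans_lt hmn) (Real.sqrt_nonneg _)
    fun y hy => exists_mem_span_abs_sub_le a y (Real.sqrt_nonneg _) fun x hx => ?_
  have hy2 := sum_sq_le_one_of_pNorm_le_one hp1 hp2 hy
  set t := ∑ i, |x i| with ht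
  have ht0 : 0 ≤ t := Finset.sum_nonneg fun i _ => abs_nonneg _
  rcases ht0.eq_or_lt with h0 | hpos
  · have hx0 : ∀ i, x i = 0 := fun i => abs_eq_zero.1
      ((Finset.sum_eq_zero_iff_of_nonneg fun i _ => abs_nonneg (x i)).1 h0.symm i
        (Finset.mem_univ i))
    simp [hx0, ← h0]
  have hz : ∑ i, (x i / t) ^ 2 ≤ 68 / k := by
    refine sum_sq_le_of_sign_matrix_kernel hm hk hA ?_ fun r => ?_
    · simp_rw [abs_div, abs_of_pos hpos]
      rw [← Finset.sum_div, ← ht, div_self hpos.ne']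
    · simp_rw [← mul_div_assoc]
      rw [← Finset.sum_div, hx r, zero_div]
  have hcs : ∑ i, y i * (x i / t) ≤ √(68 / k) := by
    refine (Real.sum_mul_le_sqrt_mul_sqrt _ _ _).trans ?_
    calc _ ≤ 1 * √(68 / k) := by
          gcongr
          exact Real.sqrt_le_one.2 hy2
      _ = _ := one_mul _
  simp_rw [← mul_div_assoc] at hcs
  rwa [← Finset.sum_div, div_le_iff₀ hpos] at hcs

lemma card_sym_le_exp {J : Type*} [Fintype J] [DecidableEq J] {k : ℕ}
    (hk : 0 < k) :
    (Fintype.card (Sym J k) : ℝ) ≤ Real.exp (k * (1 + Real.log ((Fintype.card J + k) / k))) := by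
  have hk' : (0 : ℝ) < k := by exact_mod_cast hk
  have h1 : (Fintype.card (Sym J k) : ℝ) ≤ ((Fintype.card J + k : ℕ) : ℝ) ^ k / k.factorial := by
    rw [Sym.card_sym_eq_choose]
    refine (Nat.choose_le_pow_div k _).trans ?_
    gcongr
    omega
  have h2 := Real.pow_div_factorial_le_exp (x := k) hk'.le k
  have h3 : (0 : ℝ) < (Fintype.card J + k) / k := by positivity
  calc _ ≤ _ := h1
    _ = ((Fintype.card J + k) / k : ℝ) ^ k * ((k : ℝ) ^ k / k.factorial) := by
      rw [div_pow]
      push_cast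
      field_simp
    _ ≤ ((Fintype.card J + k) / k : ℝ) ^ k * Real.exp k := by gcongr
    _ = _ := by
      rw [mul_add (k : ℝ), Real.exp_add, mul_one, Real.exp_nat_mul, Real.exp_log h3, mul_comm]

/-- For `1 ≤ p < 2` there is `C > 0` such that for all `1 ≤ n ≤ N/4`,
`d_n(id : ℓ_p^N → ℓ_∞^N) ≤ C · n^{-1/2} · (log(eN/n))^{3/2}`. -/
theorem kolmogorov_lp_linfty_upper (p : ℝ) (hp1 : 1 ≤ p) (hp2 : p < 2) :
    ∃ C : ℝ, 0 < C ∧ ∀ N n : ℕ, 1 ≤ n → (n : ℝ) ≤ (N : ℝ) / 4 →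
      kolmogorovNumber (ENNReal.ofReal p) ∞ N n ≤
        C * (n : ℝ) ^ (-(1/2) : ℝ) *
          (Real.log (Real.exp 1 * N / n)) ^ ((3 : ℝ)/2) := by
  refine ⟨200, by norm_num, fun N n hn hN => ?_⟩
  have hn' : (1 : ℝ) ≤ n := by exact_mod_cast hn
  have hn0 : (0 : ℝ) < n := by linarith
  have hN0 : (0 : ℝ) < N := by linarith
  set L := Real.log (Real.exp 1 * N / n) with hL
  have hLN : L = 1 + Real.log (N / n) := by
    rw [hL, mul_div_assoc, Real.log_mul (Real.exp_ne_zero 1) (by positivity), Real.log_exp]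
  have hL1 : 1 ≤ L := by
    have : 0 ≤ Real.log (N / n) := Real.log_nonneg (by rw [le_div_iff₀ hn0]; linarith)
    linarith
  have hL0 : 0 < L := by linarith
  have hrate : √(L / n) ≤ (n : ℝ) ^ (-(1 / 2) : ℝ) * L ^ ((3 : ℝ) / 2) := by
    rw [Real.sqrt_eq_rpow, Real.div_rpow hL0.le hn0.le, Real.rpow_neg hn0.le, div_eq_inv_mul]
    exact mul_le_mul_of_nonneg_left (Real.rpow_le_rpow_of_exponent_le hL1 (by norm_num))
      (by positivity)
  suffices h : kolmogorovNumber (ENNReal.ofReal p) ∞ N n ≤ 200 * √(L / n) by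
    rw [mul_assoc]
    linarith
  have hscale : 200 * √(L / n) = √(40000 * L / n) := by
    rw [mul_div_assoc, Real.sqrt_mul (by norm_num), show (40000 : ℝ) = 200 ^ 2 by norm_num,
      Real.sqrt_sq (by norm_num)]
  rw [hscale]
  set k := ⌊n / (256 * L)⌋₊ with hk
  have hklt : n / (256 * L) < k + 1 := Nat.lt_floor_add_one _
  rw [div_lt_iff₀ (by positivity)] at hklt
  rcases Nat.eq_zero_or_pos k with h0 | hkpos
  · refine (kolmogorovNumber_le_one hp1 hp2 hn).trans (Real.one_le_sqrt.2 ?_)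
    rw [le_div_iff₀ hn0]
    rw [h0, Nat.cast_zero] at hklt
    linarith
  have hk1 : (1 : ℝ) ≤ k := by exact_mod_cast hkpos
  have hkle : (k : ℝ) ≤ n / (256 * L) := Nat.floor_le (by positivity)
  rw [le_div_iff₀ (by positivity)] at hkle
  have hkL : L ≤ k * L := by nlinarith
  have hn256 : (256 : ℝ) ≤ n := by nlinarith
  have hn2 : 2 ≤ n := by
    have : (2 : ℝ) ≤ n := by linarith
    exact_mod_cast this
  have hkn : (k : ℝ) ≤ n := by nlinarith
  refine (kolmogorovNumber_le_sqrt (m := n - 1) hp1 hp2 (by omega) (by omega) hkpos ?_).trans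
    (Real.sqrt_le_sqrt ?_)
  · have hm : ((n - 1 : ℕ) : ℝ) = n - 1 := by
      rw [Nat.cast_sub hn, Nat.cast_one]
    have hcJ : (Fintype.card (Fin N × Bool) : ℝ) = 2 * N := by
      simp [mul_comm]
    have hlog : Real.log ((2 * N + k) / k) ≤ 8 * L := by
      have h1 : (2 * N + k) / k ≤ 1536 * (L * (N / n)) := by
        rw [div_le_iff₀ (by linarith)]
        have h2 : (n : ℝ) ≤ 512 * L * k := by nlinarith
        calc (2 * N + k : ℝ) ≤ 3 * N := by linarith
          _ = 3 * (N / n) * n := by field_simp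
          _ ≤ 3 * (N / n) * (512 * L * k) := by gcongr
          _ = _ := by ring
      have h3 : Real.log 1536 ≤ 8 := by
        rw [Real.log_le_iff_le_exp (by norm_num), show (8 : ℝ) = (8 : ℕ) * 1 by norm_num,
          Real.exp_nat_mul]
        calc (1536 : ℝ) ≤ 2.7 ^ 8 := by norm_num
          _ ≤ _ := by
            have := Real.exp_one_gt_d9
            gcongr
            linarith
      have h4 := Real.log_le_sub_one_of_pos hL0
      refine (Real.log_le_log (by positivity) h1).trans ?_
      rw [Real.log_mul (by norm_num) (by positivity), Real.log_mul hL0.ne' (by positivity)]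
      linarith
    calc _ ≤ Real.exp (k * (1 + Real.log ((2 * N + k) / k))) * Real.exp (-((n - 1) / 8)) := by
          rw [hm, ← hcJ]
          gcongr
          exact card_sym_le_exp hkpos
      _ < 1 := by
          rw [← Real.exp_add, Real.exp_lt_one_iff]
          have h5 : k * (1 + Real.log ((2 * N + k) / k)) ≤ k * (9 * L) := by
            gcongr
            linarith
          linarith
  · rw [div_le_div_iff₀ (by linarith) hn0]
    nlinarith
end

section
/- Let 2 ≤ p < ∞. There exist absolute constants c₁ > 0 and c₂ > 0 such that for all N, n ∈ ℕ with 2 ≤ n ≤ N, the n-th Kolmogorov number of the identity map from ℓ_p^N to ℓ_∞^N satisfies (1/4) · min{ 1, (c₁ · log(1 + N/(n−1)) / (n−1))^{1/p} } ≤ d_n(id : ℓ_p^N → ℓ_∞^N) ≤ min{ 1, (c₂ · log(1 + N/(n−1)) / (n−1))^{1/p} }. -/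
open scoped ENNReal BigOperators

namespace KolmogorovWidth

open Finset MeasureTheory Metric Module

/-! ### The definition of the Kolmogorov numbers in terms of the sup-norm -/

lemma pNorm_top {N : ℕ} (x : Fin N → ℝ) : pNorm ∞ x = ‖x‖ := by
  rw [pNorm, if_pos rfl]
  refine le_antisymm (Real.iSup_le (fun i => ?_) (norm_nonneg x))
    ((pi_norm_le_iff_of_nonneg (Real.iSup_nonneg fun i => abs_nonneg _)).2 fun i => ?_)
  · exact norm_le_pi_norm x i
  · exact le_ciSup (f := fun i => |x i|) (Set.finite_range _).bddAbove i

lemma pNorm_ofReal_le_one_iff {p : ℝ} (hp : 0 < p) {N : ℕ} (x : Fin N → ℝ) :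
    pNorm (ENNReal.ofReal p) x ≤ 1 ↔ ∑ i, |x i| ^ p ≤ 1 := by
  have h0 : 0 ≤ ∑ i, |x i| ^ p := sum_nonneg fun i _ => Real.rpow_nonneg (abs_nonneg _) _
  rw [pNorm, if_neg ENNReal.ofReal_ne_top, ENNReal.toReal_ofReal hp.le]
  constructor
  · intro h
    by_contra! h1
    exact absurd h (not_le.2 (Real.one_lt_rpow h1 (by positivity)))
  · intro h
    exact Real.rpow_le_one h0 h (by positivity)

lemma norm_le_one_of_sum_rpow_le_one {p : ℝ} (hp : 0 < p) {N : ℕ} {x : Fin N → ℝ}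
    (hx : ∑ i, |x i| ^ p ≤ 1) : ‖x‖ ≤ 1 := by
  refine (pi_norm_le_iff_of_nonneg zero_le_one).2 fun i => ?_
  have h1 : |x i| ^ p ≤ 1 :=
    (single_le_sum (f := fun i => |x i| ^ p)
      (fun i _ => Real.rpow_nonneg (abs_nonneg _) _) (mem_univ i)).trans hx
  by_contra! h
  exact absurd h1 (not_le.2 (Real.one_lt_rpow h hp))

lemma dist_set_bddBelow {N : ℕ} (V : Submodule ℝ (Fin N → ℝ)) (x : Fin N → ℝ) :
    BddBelow { t : ℝ | ∃ v ∈ V, t = pNorm ∞ (x - v) } := by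
  refine ⟨0, ?_⟩
  rintro _ ⟨v, -, rfl⟩
  rw [pNorm_top]
  exact norm_nonneg _

lemma le_kolmogorovNumber {p c : ℝ} (hp : 0 < p) {N n : ℕ} (hn : 0 < n)
    (h : ∀ V : Submodule ℝ (Fin N → ℝ), finrank ℝ V < n →
      ∃ x : Fin N → ℝ, ∑ i, |x i| ^ p ≤ 1 ∧ ∀ v ∈ V, c ≤ ‖x - v‖) :
    c ≤ kolmogorovNumber (ENNReal.ofReal p) ∞ N n := by
  refine le_csInf ⟨_, ⊥, by simpa using hn, rfl⟩ ?_
  rintro _ ⟨V, hV, rfl⟩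
  obtain ⟨x, hx, hxc⟩ := h V hV
  refine le_csSup_of_le ?_ ⟨x, (pNorm_ofReal_le_one_iff hp x).2 hx, rfl⟩
    (le_csInf ⟨_, 0, V.zero_mem, rfl⟩ ?_)
  · refine ⟨1, ?_⟩
    rintro _ ⟨y, hy, rfl⟩
    refine csInf_le_of_le (dist_set_bddBelow V y) ⟨0, V.zero_mem, rfl⟩ ?_
    rw [pNorm_top, sub_zero]
    exact norm_le_one_of_sum_rpow_le_one hp ((pNorm_ofReal_le_one_iff hp y).1 hy)
  · rintro _ ⟨v, hv, rfl⟩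
    rw [pNorm_top]
    exact hxc v hv

lemma kolmogorovNumber_le {p c : ℝ} (hp : 0 < p) (hc : 0 ≤ c) {N n : ℕ}
    (V : Submodule ℝ (Fin N → ℝ)) (hV : finrank ℝ V < n)
    (h : ∀ x : Fin N → ℝ, ∑ i, |x i| ^ p ≤ 1 → ∀ ε > 0, ∃ v ∈ V, ‖x - v‖ ≤ c + ε) :
    kolmogorovNumber (ENNReal.ofReal p) ∞ N n ≤ c := by
  refine csInf_le_of_le ?_ ⟨V, hV, rfl⟩ (Real.sSup_le ?_ hc)
  · refine ⟨0, ?_⟩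
    rintro _ ⟨W, -, rfl⟩
    refine Real.sSup_nonneg ?_
    rintro _ ⟨x, -, rfl⟩
    refine Real.sInf_nonneg ?_
    rintro _ ⟨v, -, rfl⟩
    rw [pNorm_top]
    exact norm_nonneg _
  · rintro _ ⟨x, hx, rfl⟩
    refine le_of_forall_pos_le_add fun ε hε => ?_
    obtain ⟨v, hv, hvε⟩ := h x ((pNorm_ofReal_le_one_iff hp x).1 hx) ε hε
    refine csInf_le_of_le (dist_set_bddBelow V x) ⟨v, hv, rfl⟩ ?_
    rwa [pNorm_top]

/-! ### Lower bounds -/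

/-- Volume bound for the cardinality of a `1`-separated set in a ball of radius `R`. -/
lemma card_le_of_one_separated {E : Type*} [NormedAddCommGroup E] [NormedSpace ℝ E]
    [FiniteDimensional ℝ E] {R : ℝ} (hR : 0 ≤ R) (s : Finset E) (hs : ∀ c ∈ s, ‖c‖ ≤ R)
    (h : ∀ c ∈ s, ∀ d ∈ s, c ≠ d → 1 ≤ ‖c - d‖) :
    (s.card : ℝ) ≤ (2 * R + 1) ^ finrank ℝ E := by
  borelize E
  let μ : Measure E := Measure.addHaar
  have hδ : (0 : ℝ) < 1 / 2 := by norm_num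
  have hρ : 0 < R + 1 / 2 := by positivity
  have hdisj : (s : Set E).PairwiseDisjoint fun c => ball c (1 / 2 : ℝ) := by
    intro c hc d hd hcd
    apply ball_disjoint_ball
    rw [dist_eq_norm]
    linarith [h c hc d hd hcd]
  have hsub : ⋃ c ∈ s, ball c (1 / 2 : ℝ) ⊆ ball (0 : E) (R + 1 / 2) := by
    refine Set.iUnion₂_subset fun x hx => ball_subset_ball' ?_
    rw [dist_zero_right]
    linarith [hs x hx]
  have hvol : (s.card : ℝ≥0∞) * ENNReal.ofReal ((1 / 2) ^ finrank ℝ E) * μ (ball 0 1) ≤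
      ENNReal.ofReal ((R + 1 / 2) ^ finrank ℝ E) * μ (ball 0 1) := by
    rw [← μ.addHaar_ball_of_pos 0 hρ]
    refine le_trans (le_of_eq ?_) (measure_mono hsub)
    rw [measure_biUnion_finset hdisj fun c _ => measurableSet_ball]
    simp only [μ.addHaar_ball_of_pos _ hδ, Finset.sum_const, nsmul_eq_mul, mul_assoc]
  have hcard := ENNReal.toReal_le_of_le_ofReal (pow_nonneg hρ.le _)
    ((ENNReal.mul_le_mul_iff_left (measure_ball_pos μ _ zero_lt_one).ne'
      measure_ball_lt_top.ne).1 hvol)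
  rw [ENNReal.toReal_mul, ENNReal.toReal_natCast, ENNReal.toReal_ofReal (by positivity)] at hcard
  have h2 : (2 * R + 1) ^ finrank ℝ E = (R + 1 / 2) ^ finrank ℝ E * 2 ^ finrank ℝ E := by
    rw [← mul_pow]; ring_nf
  calc (s.card : ℝ) = s.card * (1 / 2) ^ finrank ℝ E * 2 ^ finrank ℝ E := by
        rw [mul_assoc, ← mul_pow]; norm_num
    _ ≤ _ := by rw [h2]; gcongr

/-- If there are many `0`-`1` vectors with `s` ones, then one of them is far from `V`. -/
lemma exists_indicator_far {N s : ℕ} (V : Submodule ℝ (Fin N → ℝ))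
    (hV : (6 : ℝ) ^ finrank ℝ V < N.choose s) :
    ∃ S : Finset (Fin N), S.card = s ∧
      ∀ v ∈ V, 1 / 4 ≤ ‖(fun i => if i ∈ S then (1 : ℝ) else 0) - v‖ := by
  by_contra! hcon
  let e : Finset (Fin N) → Fin N → ℝ := fun S i => if i ∈ S then 1 else 0
  have hcon' : ∀ S : Finset (Fin N), ∃ v : V, S.card = s → ‖e S - v‖ < 1 / 4 := fun S => by
    by_cases hS : S.card = s
    · obtain ⟨v, hv, h⟩ := hcon S hS
      exact ⟨⟨v, hv⟩, fun _ => h⟩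
    · exact ⟨0, fun h => absurd h hS⟩
  choose f hf using hcon'
  have hsep : ∀ S T : Finset (Fin N), S.card = s → T.card = s → S ≠ T →
      1 ≤ ‖(2 : ℝ) • f S - (2 : ℝ) • f T‖ := by
    intro S T hS hT hST
    have h1 : 1 ≤ ‖e S - e T‖ := by
      obtain ⟨i, hi⟩ : ∃ i, ¬ (i ∈ S ↔ i ∈ T) := by
        by_contra! h
        exact hST (Finset.ext h)
      refine le_trans ?_ (norm_le_pi_norm _ i)
      by_cases h : i ∈ S <;> by_cases h' : i ∈ T <;> simp_all [e]
    have h2 : ‖e S - e T‖ ≤ ‖e S - f S‖ + ‖(f S : Fin N → ℝ) - f T‖ + ‖e T - f T‖ := by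
      rw [norm_sub_rev (e T)]
      refine le_trans (le_of_eq ?_) norm_add₃_le
      congr 1
      abel
    have h3 : (2 : ℝ) • f S - (2 : ℝ) • f T = (2 : ℝ) • (f S - f T) := (smul_sub _ _ _).symm
    rw [h3, norm_smul, Submodule.coe_norm, Submodule.coe_sub]
    norm_num
    linarith [hf S hS, hf T hT]
  have hinj : Set.InjOn (fun S => (2 : ℝ) • f S) (powersetCard s (univ : Finset (Fin N))) := by
    intro S hS T hT hST
    by_contra hne
    have := hsep S T (mem_powersetCard.1 hS).2 (mem_powersetCard.1 hT).2 hne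
    rw [show (2 : ℝ) • f S = (2 : ℝ) • f T from hST, sub_self, norm_zero] at this
    norm_num at this
  have hcard := card_le_of_one_separated (R := 5 / 2) (by norm_num)
    ((powersetCard s (univ : Finset (Fin N))).image fun S => (2 : ℝ) • f S) ?_ ?_
  · rw [card_image_of_injOn hinj, card_powersetCard, card_univ, Fintype.card_fin] at hcard
    norm_num at hcard
    linarith
  · intro c hc
    obtain ⟨S, hS, rfl⟩ := mem_image.1 hc
    have h1 : ‖e S‖ ≤ 1 := (pi_norm_le_iff_of_nonneg zero_le_one).2 fun i => by
      by_cases h : i ∈ S <;> simp [e, h]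
    have h2 : ‖(f S : Fin N → ℝ)‖ ≤ ‖e S‖ + ‖e S - f S‖ := by
      rw [norm_sub_rev]
      exact norm_le_norm_add_norm_sub' _ _
    rw [norm_smul, Submodule.coe_norm]
    norm_num
    linarith [hf S (mem_powersetCard.1 hS).2]
  · intro c hc d hd hcd
    obtain ⟨S, hS, rfl⟩ := mem_image.1 hc
    obtain ⟨T, hT, rfl⟩ := mem_image.1 hd
    exact hsep S T (mem_powersetCard.1 hS).2 (mem_powersetCard.1 hT).2
      (fun h => hcd (by rw [h]))

lemma le_kolmogorovNumber_of_choose {p : ℝ} (hp : 0 < p) {N n s : ℕ} (hn : 0 < n) (hs : 0 < s)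
    (h : (6 : ℝ) ^ (n - 1) < N.choose s) :
    1 / 4 * (1 / (s : ℝ)) ^ (1 / p) ≤ kolmogorovNumber (ENNReal.ofReal p) ∞ N n := by
  refine le_kolmogorovNumber hp hn fun V hV => ?_
  obtain ⟨S, hS, hSV⟩ := exists_indicator_far V (s := s)
    ((pow_le_pow_right₀ (by norm_num) (Nat.le_sub_one_of_lt hV)).trans_lt h)
  have hs' : (0 : ℝ) < s := by exact_mod_cast hs
  set r : ℝ := (1 / (s : ℝ)) ^ (1 / p) with hr
  have hr0 : 0 < r := by positivity
  have hrp : r ^ p = 1 / s := by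
    rw [hr, ← Real.rpow_mul (by positivity), one_div_mul_cancel hp.ne', Real.rpow_one]
  refine ⟨r • fun i => if i ∈ S then 1 else 0, ?_, fun v hv => ?_⟩
  · have : ∀ i, |(r • fun i => if i ∈ S then (1 : ℝ) else 0) i| ^ p = if i ∈ S then r ^ p else 0 := by
      intro i
      by_cases hi : i ∈ S
      · simp [hi, abs_of_pos hr0]
      · simp [hi, Real.zero_rpow hp.ne']
    rw [sum_congr rfl fun i _ => this i, ← sum_filter, sum_const, hrp]
    simp [hS, hs'.ne']
  · have h1 := hSV (r⁻¹ • v) (V.smul_mem _ hv)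
    have h2 : (r • fun i => if i ∈ S then (1 : ℝ) else 0) - v
        = r • ((fun i => if i ∈ S then (1 : ℝ) else 0) - r⁻¹ • v) := by
      rw [smul_sub, smul_inv_smul₀ hr0.ne']
    rw [h2, norm_smul, Real.norm_of_nonneg hr0.le]
    nlinarith

lemma rpow_inv_card_le_kolmogorovNumber {p : ℝ} (hp : 0 < p) {N n : ℕ} (hn : 0 < n) (hnN : n ≤ N) :
    1 / 4 * (1 / (N : ℝ)) ^ (1 / p) ≤ kolmogorovNumber (ENNReal.ofReal p) ∞ N n := by
  refine le_kolmogorovNumber hp hn fun V hV => ?_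
  have hN : (0 : ℝ) < N := by exact_mod_cast hn.trans_le hnN
  have hex : ∃ x, x ∉ V := by
    by_contra! h
    rw [(Submodule.eq_top_iff').2 h, finrank_top, finrank_fin_fun] at hV
    omega
  obtain ⟨x, -, hx1, hxV⟩ := riesz_lemma_of_lt_one V.closed_of_finiteDimensional hex
    (r := 1 / 4) (by norm_num)
  set r : ℝ := (1 / (N : ℝ)) ^ (1 / p) with hr
  have hr0 : 0 < r := by positivity
  have hrp : r ^ p = 1 / N := by
    rw [hr, ← Real.rpow_mul (by positivity), one_div_mul_cancel hp.ne', Real.rpow_one]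
  refine ⟨r • x, ?_, fun v hv => ?_⟩
  · calc ∑ i, |(r • x) i| ^ p ≤ ∑ _i : Fin N, r ^ p := by
          refine sum_le_sum fun i _ => Real.rpow_le_rpow (abs_nonneg _) ?_ hp.le
          rw [Pi.smul_apply, smul_eq_mul, abs_mul, abs_of_pos hr0]
          have := norm_le_pi_norm x i
          rw [hx1, Real.norm_eq_abs] at this
          nlinarith
      _ = 1 := by
          rw [sum_const, hrp, card_univ, Fintype.card_fin, nsmul_eq_mul]
          field_simp
      _ ≤ 1 := le_rfl
  · have h1 := hxV (r⁻¹ • v) (V.smul_mem _ hv)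
    have h2 : r • x - v = r • (x - r⁻¹ • v) := by rw [smul_sub, smul_inv_smul₀ hr0.ne']
    rw [h2, norm_smul, Real.norm_of_nonneg hr0.le]
    nlinarith

lemma div_pow_le_choose {N s : ℕ} (hsN : s ≤ N) : ((N : ℝ) / s) ^ s ≤ N.choose s := by
  induction s generalizing N with
  | zero => simp
  | succ s ih =>
    obtain ⟨M, rfl⟩ : ∃ M, N = M + 1 := ⟨N - 1, by omega⟩
    have hsM : s ≤ M := by omega
    have h1 : ((M + 1).choose (s + 1) : ℝ) = ((M + 1 : ℕ) : ℝ) / (s + 1 : ℕ) * M.choose s := by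
      rw [div_mul_eq_mul_div, eq_div_iff (by positivity)]
      exact_mod_cast (Nat.add_one_mul_choose_eq M s).symm
    rw [h1, pow_succ']
    refine mul_le_mul_of_nonneg_left (le_trans ?_ (ih hsM)) (by positivity)
    rcases Nat.eq_zero_or_pos s with rfl | hs
    · simp
    · refine pow_le_pow_left₀ (by positivity) ?_ _
      rw [div_le_div_iff₀ (by positivity) (by positivity)]
      have : (s : ℝ) ≤ M := by exact_mod_cast hsM
      push_cast
      nlinarith

lemma six_pow_lt_choose {m N s : ℕ} (hm : 0 < m) (h17 : 17 ≤ (N : ℝ) / m)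
    (hs : s = ⌈(m : ℝ) / (1 / 4 * Real.log (1 + (N : ℝ) / m))⌉₊) :
    (6 : ℝ) ^ m < N.choose s := by
  have hm' : (0 : ℝ) < m := by exact_mod_cast hm
  have hm1 : (1 : ℝ) ≤ m := by exact_mod_cast hm
  set x : ℝ := (N : ℝ) / m with hx
  have hN : (N : ℝ) = x * m := by rw [hx]; field_simp
  set L := Real.log (1 + x) with hL
  have hL2 : 2 ≤ L := by
    rw [hL, Real.le_log_iff_exp_le (by linarith)]
    have := Real.exp_one_lt_d9
    have h2 : Real.exp 2 = Real.exp 1 ^ 2 := by rw [← Real.exp_nat_mul]; norm_num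
    rw [h2]
    nlinarith [Real.exp_pos 1]
  set y : ℝ := (m : ℝ) / (1 / 4 * L) with hy
  have hy0 : 0 < y := by positivity
  have hyL : y * L = 4 * m := by rw [hy]; field_simp
  have hs0 : 0 < s := hs ▸ Nat.ceil_pos.2 hy0
  have hs0' : (0 : ℝ) < s := by exact_mod_cast hs0
  have hys : y ≤ s := hs ▸ Nat.le_ceil y
  have hsqrt : √(1 + x) ≤ x / 4 := by
    rw [Real.sqrt_le_left (by linarith)]
    nlinarith
  have hsN : √(1 + x) ≤ N / s := by
    rcases le_total y 1 with h | h
    · have : s = 1 := le_antisymm (hs ▸ Nat.ceil_le.2 (by simpa using h)) hs0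
      rw [this, Nat.cast_one, div_one]
      nlinarith
    · have h1 : (s : ℝ) ≤ 2 * y := by
        have := (Nat.ceil_lt_add_one hy0.le).le
        rw [← hs] at this
        linarith
      have h2 : y ≤ 2 * m := by nlinarith
      rw [le_div_iff₀ hs0']
      calc √(1 + x) * s ≤ x / 4 * (2 * y) := by gcongr
        _ ≤ x / 4 * (2 * (2 * m)) := by gcongr
        _ = N := by rw [hN]; ring
  have hsN1 : (1 : ℝ) ≤ N / s := le_trans (Real.one_le_sqrt.2 (by linarith)) hsN
  have hsN' : s ≤ N := by
    rw [one_le_div hs0'] at hsN1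
    exact_mod_cast hsN1
  refine lt_of_lt_of_le ?_ (div_pow_le_choose hsN')
  have hlog : L / 2 ≤ Real.log (N / s) := by
    rw [hL, ← Real.log_sqrt (by linarith)]
    exact Real.log_le_log (Real.sqrt_pos.2 (by linarith)) hsN
  have hlog6 : Real.log 6 < 2 := by
    rw [Real.log_lt_iff_lt_exp (by norm_num)]
    have := Real.exp_one_gt_d9
    have h2 : Real.exp 2 = Real.exp 1 ^ 2 := by rw [← Real.exp_nat_mul]; norm_num
    rw [h2]
    nlinarith
  rw [← Real.log_lt_log_iff (by positivity) (by positivity), Real.log_pow, Real.log_pow]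
  nlinarith

lemma kolmogorovNumber_lower {p : ℝ} (hp : 0 < p) {N n : ℕ} (hn : 2 ≤ n) (hnN : n ≤ N) :
    1 / 4 * min 1 ((1 / 100 * Real.log (1 + (N : ℝ) / ((n : ℝ) - 1)) / ((n : ℝ) - 1)) ^ (1 / p))
      ≤ kolmogorovNumber (ENNReal.ofReal p) ∞ N n := by
  obtain ⟨m, rfl⟩ : ∃ m, n = m + 1 := ⟨n - 1, by omega⟩
  have hm : 0 < m := by omega
  have hm' : (0 : ℝ) < m := by exact_mod_cast hm
  have hmN : (m : ℝ) < N := by exact_mod_cast hnN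
  have hp' : 0 ≤ 1 / p := by positivity
  have hcast : (((m + 1 : ℕ) : ℝ) - 1) = m := by push_cast; ring
  rw [hcast]
  have hx1 : 1 < (N : ℝ) / m := (one_lt_div hm').2 hmN
  have hL0 : 0 < Real.log (1 + (N : ℝ) / m) := Real.log_pos (by linarith)
  rcases le_or_gt 17 ((N : ℝ) / m) with h17 | h17
  · have hchoose := six_pow_lt_choose hm h17 rfl
    set L := Real.log (1 + (N : ℝ) / m)
    set y : ℝ := (m : ℝ) / (1 / 4 * L) with hy
    have hy0 : 0 < y := by positivity
    have hs0 : 0 < ⌈y⌉₊ := Nat.ceil_pos.2 hy0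
    have hs0' : (0 : ℝ) < ⌈y⌉₊ := by exact_mod_cast hs0
    refine le_trans ?_ (le_kolmogorovNumber_of_choose hp (n := m + 1) (by omega) hs0 hchoose)
    refine mul_le_mul_of_nonneg_left ?_ (by norm_num)
    rcases le_total y 1 with h | h
    · have : ⌈y⌉₊ = 1 := le_antisymm (Nat.ceil_le.2 (by simpa using h)) hs0
      rw [this]
      simp
    · refine min_le_of_right_le (Real.rpow_le_rpow (by positivity) ?_ hp')
      have h1 : (⌈y⌉₊ : ℝ) ≤ 2 * y := by linarith [(Nat.ceil_lt_add_one hy0.le).le]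
      have h2 : y * L = 4 * m := by rw [hy]; field_simp
      rw [div_le_div_iff₀ hm' hs0']
      nlinarith
  · refine le_trans ?_ (rpow_inv_card_le_kolmogorovNumber hp (n := m + 1) (by omega) hnN)
    refine mul_le_mul_of_nonneg_left (min_le_of_right_le ?_) (by norm_num)
    refine Real.rpow_le_rpow (by positivity) ?_ hp'
    have hL3 : Real.log (1 + (N : ℝ) / m) ≤ 3 := by
      rw [Real.log_le_iff_le_exp (by linarith)]
      have := Real.exp_one_gt_d9
      have h2 : Real.exp 3 = Real.exp 1 ^ 3 := by rw [← Real.exp_nat_mul]; norm_num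
      rw [h2]
      have : (2.7 : ℝ) ^ 3 ≤ Real.exp 1 ^ 3 := pow_le_pow_left₀ (by norm_num) (by linarith) _
      norm_num at this
      linarith
    rw [div_lt_iff₀ hm'] at h17
    rw [div_le_div_iff₀ hm' (by linarith)]
    nlinarith

/-! ### Random signs -/

/-- The real number `1` or `-1` encoded by a boolean. -/
def boolSign (b : Bool) : ℝ := if b then 1 else -1

lemma boolSign_sq (b : Bool) : boolSign b ^ 2 = 1 := by cases b <;> simp [boolSign]

lemma sum_fin_succ_bool {N : ℕ} (F : (Fin (N + 1) → Bool) → ℝ) :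
    ∑ e, F e = ∑ e : Fin N → Bool, (F (Fin.cons true e) + F (Fin.cons false e)) := by
  rw [← (Fin.consEquiv fun _ => Bool).sum_comp, Fintype.sum_prod_type_right]
  simp [Fin.consEquiv]

lemma sum_signs_sq {N : ℕ} (a : Fin N → ℝ) :
    ∑ e : Fin N → Bool, (∑ i, a i * boolSign (e i)) ^ 2 = 2 ^ N * ∑ i, a i ^ 2 := by
  induction N with
  | zero => simp
  | succ N ih =>
    rw [sum_fin_succ_bool]
    simp only [Fin.sum_univ_succ, Fin.cons_zero, Fin.cons_succ]
    have h := ih fun i => a i.succ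
    calc _ = ∑ e : Fin N → Bool, (2 * a 0 ^ 2 + 2 * (∑ i, a i.succ * boolSign (e i)) ^ 2) := by
          refine sum_congr rfl fun e _ => ?_
          simp [boolSign]; ring
      _ = _ := by
          simp only [sum_add_distrib, ← mul_sum, h]
          simp
          ring

lemma sum_signs_pow_four_le {N : ℕ} (a : Fin N → ℝ) :
    ∑ e : Fin N → Bool, (∑ i, a i * boolSign (e i)) ^ 4 ≤ 3 * 2 ^ N * (∑ i, a i ^ 2) ^ 2 := by
  induction N with
  | zero => simp
  | succ N ih =>
    rw [sum_fin_succ_bool]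
    simp only [Fin.sum_univ_succ, Fin.cons_zero, Fin.cons_succ]
    have h := ih fun i => a i.succ
    have h2 := sum_signs_sq fun i => a i.succ
    calc _ = ∑ e : Fin N → Bool, (2 * a 0 ^ 4 + 12 * a 0 ^ 2 * (∑ i, a i.succ * boolSign (e i)) ^ 2
            + 2 * (∑ i, a i.succ * boolSign (e i)) ^ 4) := by
          refine sum_congr rfl fun e _ => ?_
          simp [boolSign]; ring
      _ ≤ _ := by
          simp only [sum_add_distrib, ← mul_sum, h2]
          simp only [sum_const, card_univ, Fintype.card_pi, Fintype.card_bool, prod_const,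
            Fintype.card_fin, nsmul_eq_mul]
          push_cast
          have h0 : 0 ≤ (2 : ℝ) ^ N * a 0 ^ 4 := by positivity
          rw [pow_succ (2 : ℝ) N]
          linarith

lemma exp_neg_le {y : ℝ} (hy : 0 ≤ y) : Real.exp (-y) ≤ 1 - y + y ^ 2 / 2 := by
  have h := Real.quadratic_le_exp_of_nonneg hy
  rw [Real.exp_neg, inv_le_iff_one_le_mul₀ (Real.exp_pos y)]
  have h1 : 0 < 1 - y + y ^ 2 / 2 := by nlinarith [sq_nonneg (y - 1)]
  have h2 := mul_le_mul_of_nonneg_left h h1.le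
  nlinarith [sq_nonneg (y ^ 2)]

lemma sum_signs_exp_le {N : ℕ} (a : Fin N → ℝ) (ha : ∑ i, a i ^ 2 = 1) :
    ∑ e : Fin N → Bool, Real.exp (-(1 / 3 * (∑ i, a i * boolSign (e i)) ^ 2)) ≤
      2 ^ N * (5 / 6) := by
  calc _ ≤ ∑ e : Fin N → Bool, (1 - 1 / 3 * (∑ i, a i * boolSign (e i)) ^ 2
          + 1 / 18 * (∑ i, a i * boolSign (e i)) ^ 4) := by
        refine sum_le_sum fun e _ => (exp_neg_le (by positivity)).trans (le_of_eq ?_)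
        ring
    _ ≤ _ := by
        rw [sum_add_distrib, sum_sub_distrib, ← mul_sum, ← mul_sum, sum_signs_sq, ha]
        have h := sum_signs_pow_four_le a
        rw [ha] at h
        simp only [sum_const, card_univ, Fintype.card_pi, Fintype.card_bool, prod_const,
            Fintype.card_fin, nsmul_eq_mul]
        push_cast
        linarith

lemma five_sixths_mul_exp_le : 5 / 6 * Real.exp (1 / 12) ≤ Real.exp (-(1 / 20)) := by
  have h : Real.exp (1 / 12) * Real.exp (1 / 20) ≤ 6 / 5 := by
    rw [← Real.exp_add]
    have h1 : Real.exp (1 / 12 + 1 / 20) ≤ 1 + (1 / 12 + 1 / 20) + (1 / 12 + 1 / 20) ^ 2 := by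
      have := Real.abs_exp_sub_one_sub_id_le (x := 1 / 12 + 1 / 20) (by norm_num [abs_le])
      linarith [(abs_le.1 this).2]
    norm_num at h1 ⊢
    linarith
  rw [Real.exp_neg, ← one_div, le_div_iff₀ (Real.exp_pos _)]
  linarith

/-- Lower tail bound: few sign matrices shrink a given vector by more than a factor `2`. -/
lemma card_signs_lt_le {N : ℕ} (m : ℕ) (u : Fin N → ℝ) :
    ((univ.filter fun A : Fin m → Fin N → Bool =>
      ∑ r, (∑ i, u i * boolSign (A r i)) ^ 2 < m / 4 * ∑ i, u i ^ 2).card : ℝ) ≤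
      (2 ^ N) ^ m * Real.exp (-(m / 20)) := by
  rcases (sum_nonneg fun i _ => sq_nonneg (u i) : 0 ≤ ∑ i, u i ^ 2).eq_or_lt with h0 | h0
  · rw [filter_false_of_mem]
    · simpa using by positivity
    · intro A _
      rw [← h0, mul_zero, not_lt]
      positivity
  set σ := √(∑ i, u i ^ 2) with hσ
  have hσ2 : σ ^ 2 = ∑ i, u i ^ 2 := Real.sq_sqrt h0.le
  have hσ0 : 0 < σ := Real.sqrt_pos.2 h0
  set a : Fin N → ℝ := fun i => u i / σ with ha
  have ha1 : ∑ i, a i ^ 2 = 1 := by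
    simp only [ha, div_pow, ← sum_div, ← hσ2]
    field_simp
  have hz : ∀ e : Fin N → Bool, ∑ i, u i * boolSign (e i) = σ * ∑ i, a i * boolSign (e i) := by
    intro e
    rw [mul_sum]
    refine sum_congr rfl fun i _ => ?_
    simp only [ha]
    field_simp
  calc _ = ∑ A ∈ univ.filter (fun A : Fin m → Fin N → Bool =>
        ∑ r, (∑ i, u i * boolSign (A r i)) ^ 2 < m / 4 * ∑ i, u i ^ 2), (1 : ℝ) := by simp
    _ ≤ ∑ A ∈ univ.filter (fun A : Fin m → Fin N → Bool =>
        ∑ r, (∑ i, u i * boolSign (A r i)) ^ 2 < m / 4 * ∑ i, u i ^ 2),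
        Real.exp (m / 12) * ∏ r, Real.exp (-(1 / 3 * (∑ i, a i * boolSign (A r i)) ^ 2)) := by
        refine sum_le_sum fun A hA => ?_
        have h := (mem_filter.1 hA).2
        simp only [hz, mul_pow, ← mul_sum, ← hσ2] at h
        rw [← Real.exp_sum, ← Real.exp_add, Real.one_le_exp_iff, sum_neg_distrib, ← mul_sum]
        have h' : σ ^ 2 * ∑ r, (∑ i, a i * boolSign (A r i)) ^ 2 < σ ^ 2 * (m / 4) := by linarith
        have := lt_of_mul_lt_mul_left h' (sq_nonneg σ)
        linarith
    _ ≤ ∑ A : Fin m → Fin N → Bool,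
        Real.exp (m / 12) * ∏ r, Real.exp (-(1 / 3 * (∑ i, a i * boolSign (A r i)) ^ 2)) :=
        sum_le_sum_of_subset_of_nonneg (filter_subset _ _) fun A _ _ => by positivity
    _ = Real.exp (m / 12) *
        (∑ e : Fin N → Bool, Real.exp (-(1 / 3 * (∑ i, a i * boolSign (e i)) ^ 2))) ^ m := by
        rw [← mul_sum, Fintype.sum_pow]
    _ ≤ Real.exp (m / 12) * (2 ^ N * (5 / 6)) ^ m := by
        gcongr
        exact sum_signs_exp_le a ha1
    _ = (2 ^ N) ^ m * (5 / 6 * Real.exp (1 / 12)) ^ m := by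
        rw [mul_pow, mul_pow (5 / 6 : ℝ), ← Real.exp_nat_mul]
        ring_nf
    _ ≤ (2 ^ N) ^ m * Real.exp (-(1 / 20)) ^ m := by
        gcongr
        exact five_sixths_mul_exp_le
    _ = _ := by
        rw [← Real.exp_nat_mul]
        ring_nf

/-! ### Empirical approximation in convex hulls -/

lemma exists_le_of_weighted_sum_le {ι : Type*} [Fintype ι] {w f : ι → ℝ} {B : ℝ}
    (hw : ∀ i, 0 ≤ w i) (hw1 : ∑ i, w i = 1) (h : ∑ i, w i * f i ≤ B) : ∃ i, f i ≤ B := by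
  by_contra! hcon
  obtain ⟨i, hi⟩ : ∃ i, 0 < w i := by
    by_contra! hle
    have : ∑ i, w i ≤ 0 := sum_nonpos fun i _ => hle i
    linarith
  have : ∑ i, w i * B < ∑ i, w i * f i :=
    sum_lt_sum (fun j _ => mul_le_mul_of_nonneg_left (hcon j).le (hw j))
      ⟨i, mem_univ i, mul_lt_mul_of_pos_left (hcon i) hi⟩
  rw [← sum_mul, hw1] at this
  linarith

/-- Maurey's empirical method, for a weighted Euclidean norm. -/
lemma exists_multiset_approx {ι κ : Type*} [Fintype ι] [Fintype κ] {w : ι → ℝ} {b : κ → ℝ}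
    {g : ι → κ → ℝ} {v : κ → ℝ} {R : ℝ} (hw : ∀ i, 0 ≤ w i) (hw1 : ∑ i, w i = 1)
    (hb : ∀ t, 0 ≤ b t) (hg : ∀ i, ∑ t, b t * g i t ^ 2 ≤ R) (hv : ∀ t, ∑ i, w i * g i t = v t)
    (k : ℕ) :
    ∃ s : Sym ι k, ∑ t, b t * (((s : Multiset ι).map fun i => g i t).sum - k * v t) ^ 2 ≤
      k * R := by
  induction k with
  | zero => exact ⟨Sym.nil, by simp⟩
  | succ k ih =>
    obtain ⟨s, hs⟩ := ih
    set S : κ → ℝ := fun t => ((s : Multiset ι).map fun i => g i t).sum - k * v t with hS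
    have key : ∑ i, w i * ∑ t, b t * (S t + g i t - v t) ^ 2 ≤ ((k + 1 : ℕ) : ℝ) * R := by
      have h1 : ∀ t, ∑ i, w i * (S t + g i t - v t) ^ 2 =
          S t ^ 2 + ∑ i, w i * g i t ^ 2 - v t ^ 2 := by
        intro t
        have : ∀ i, w i * (S t + g i t - v t) ^ 2 =
            w i * (S t - v t) ^ 2 + 2 * (S t - v t) * (w i * g i t) + w i * g i t ^ 2 := by
          intro i; ring
        rw [sum_congr rfl fun i _ => this i, sum_add_distrib, sum_add_distrib, ← sum_mul, hw1,
          ← mul_sum, hv]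
        ring
      calc ∑ i, w i * ∑ t, b t * (S t + g i t - v t) ^ 2
          = ∑ t, b t * ∑ i, w i * (S t + g i t - v t) ^ 2 := by
            simp only [mul_sum]
            rw [sum_comm]
            exact sum_congr rfl fun t _ => sum_congr rfl fun i _ => by ring
        _ ≤ ∑ t, (b t * S t ^ 2 + ∑ i, w i * (b t * g i t ^ 2)) := by
            refine sum_le_sum fun t _ => ?_
            rw [h1]
            have : ∑ i, w i * (b t * g i t ^ 2) = b t * ∑ i, w i * g i t ^ 2 := by
              rw [mul_sum]
              exact sum_congr rfl fun i _ => by ring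
            rw [this]
            nlinarith [hb t, sq_nonneg (v t)]
        _ = ∑ t, b t * S t ^ 2 + ∑ i, w i * ∑ t, b t * g i t ^ 2 := by
            rw [sum_add_distrib, sum_comm]
            simp only [mul_sum]
        _ ≤ k * R + ∑ i, w i * R := by
            gcongr with i
            · exact hw i
            · exact hg i
        _ = _ := by rw [← sum_mul, hw1]; push_cast; ring
    obtain ⟨i, hi⟩ := exists_le_of_weighted_sum_le hw hw1 key
    refine ⟨i ::ₛ s, le_trans (le_of_eq ?_) hi⟩
    refine sum_congr rfl fun t _ => ?_
    simp only [hS, Sym.coe_cons, Multiset.map_cons, Multiset.sum_cons]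
    push_cast
    ring

/-! ### Kernels of sign matrices -/

/-- The signed standard basis vectors of `ℝ^N`, together with their images under a sign matrix. -/
def signedColumn {m N : ℕ} (A : Fin m → Fin N → Bool) (j : Fin N × Bool) : Fin N ⊕ Fin m → ℝ :=
  Sum.elim (fun i => if i = j.1 then boolSign j.2 else 0)
    fun r => boolSign j.2 * boolSign (A r j.1)

/-- The sum of the signed standard basis vectors listed in a multiset. -/
def signedCount {N k : ℕ} (s : Sym (Fin N × Bool) k) (i : Fin N) : ℝ :=
  ((s : Multiset (Fin N × Bool)).map fun j => if i = j.1 then boolSign j.2 else 0).sum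

lemma sum_signedColumn_inr {m N k : ℕ} (A : Fin m → Fin N → Bool) (s : Sym (Fin N × Bool) k)
    (r : Fin m) :
    ((s : Multiset (Fin N × Bool)).map fun j => signedColumn A j (Sum.inr r)).sum =
      ∑ i, signedCount s i * boolSign (A r i) := by
  simp only [signedCount, signedColumn, Sum.elim_inr]
  induction (s : Multiset (Fin N × Bool)) using Multiset.induction_on with
  | empty => simp
  | cons j s ih => simp [ih, add_mul, sum_add_distrib, ite_mul]

lemma l2_le_l1_of_mem_ker {m N k : ℕ} (hm : 0 < m) {A : Fin m → Fin N → Bool}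
    (hA : ∀ s : Sym (Fin N × Bool) k, (m : ℝ) / 4 * ∑ i, signedCount s i ^ 2 ≤
      ∑ r, (∑ i, signedCount s i * boolSign (A r i)) ^ 2)
    {v : Fin N → ℝ} (hv : ∀ r, ∑ i, v i * boolSign (A r i) = 0) (hv1 : ∑ i, |v i| = 1) :
    k * ∑ i, v i ^ 2 ≤ 16 := by
  rcases Nat.eq_zero_or_pos k with rfl | hk
  · simp
  have hm' : (0 : ℝ) < m := by exact_mod_cast hm
  have hk' : (0 : ℝ) < k := by exact_mod_cast hk
  obtain ⟨s, hs⟩ := exists_multiset_approx (k := k) (R := 2) (g := signedColumn A)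
    (w := fun j => if j.2 then max (v j.1) 0 else max (-v j.1) 0)
    (b := Sum.elim (fun _ => 1) fun _ => (m : ℝ)⁻¹) (v := Sum.elim v fun _ => 0)
    (fun j => by split_ifs <;> exact le_max_right _ _)
    (by
      rw [Fintype.sum_prod_type, ← hv1]
      refine sum_congr rfl fun i _ => ?_
      rw [Fintype.sum_bool]
      simp only [if_true, Bool.false_eq_true, if_false]
      rcases le_total 0 (v i) with h | h
      · simp [h, abs_of_nonneg]
      · simp [h, abs_of_nonpos])
    (by rintro (t | t) <;> simp)
    (fun j => by
      rw [Fintype.sum_sum_type]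
      simp [signedColumn, mul_pow, boolSign_sq, ite_pow]
      field_simp
      norm_num)
    (by
      have hpm : ∀ i, max (v i) 0 - max (-v i) 0 = v i := fun i => by
        rcases le_total 0 (v i) with h | h <;> simp [h]
      rintro (t | t)
      · rw [Fintype.sum_prod_type]
        simp only [Fintype.sum_bool, signedColumn, Sum.elim_inl, boolSign]
        rw [sum_eq_single t (fun i _ hi => by simp [hi.symm]) (by simp)]
        have := hpm t
        simp
        linarith
      · rw [Fintype.sum_prod_type]
        simp only [Sum.elim_inr]
        refine Eq.trans ?_ (hv t)
        refine sum_congr rfl fun i _ => ?_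
        rw [Fintype.sum_bool]
        simp only [signedColumn, Sum.elim_inr, if_true, Bool.false_eq_true, if_false]
        have h1 : boolSign true = 1 := rfl
        have h2 : boolSign false = -1 := rfl
        rw [h1, h2]
        linear_combination boolSign (A t i) * hpm i)
  rw [Fintype.sum_sum_type] at hs
  simp only [sum_signedColumn_inr, Sum.elim_inl, Sum.elim_inr, one_mul, mul_zero, sub_zero,
    ← mul_sum] at hs
  have hs' : ∑ i, (signedCount s i - k * v i) ^ 2 +
      (m : ℝ)⁻¹ * ∑ r, (∑ i, signedCount s i * boolSign (A r i)) ^ 2 ≤ k * 2 := hs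
  have hA' : 1 / 4 * ∑ i, signedCount s i ^ 2 ≤
      (m : ℝ)⁻¹ * ∑ r, (∑ i, signedCount s i * boolSign (A r i)) ^ 2 := by
    rw [← mul_le_mul_iff_right₀ hm', mul_inv_cancel_left₀ hm'.ne']
    linarith [hA s]
  have h3 : k ^ 2 * ∑ i, v i ^ 2 ≤
      2 * ∑ i, signedCount s i ^ 2 + 2 * ∑ i, (signedCount s i - k * v i) ^ 2 := by
    simp only [mul_sum, ← sum_add_distrib]
    refine sum_le_sum fun i _ => ?_
    nlinarith [sq_nonneg (2 * signedCount s i - k * v i)]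
  have h4 : 0 ≤ ∑ i, (signedCount s i - k * v i) ^ 2 := sum_nonneg fun i _ => sq_nonneg _
  have h5 : (k : ℝ) * (k * ∑ i, v i ^ 2) ≤ k * 16 := by nlinarith
  exact le_of_mul_le_mul_left h5 hk'

lemma exists_good_signs {m N k : ℕ}
    (h : (Fintype.card (Sym (Fin N × Bool) k) : ℝ) * Real.exp (-(m / 20)) < 1) :
    ∃ A : Fin m → Fin N → Bool, ∀ s : Sym (Fin N × Bool) k,
      (m : ℝ) / 4 * ∑ i, signedCount s i ^ 2 ≤
        ∑ r, (∑ i, signedCount s i * boolSign (A r i)) ^ 2 := by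
  by_contra! hcon
  have h1 : (univ : Finset (Fin m → Fin N → Bool)) ⊆
      (univ : Finset (Sym (Fin N × Bool) k)).biUnion fun s => univ.filter fun A =>
        ∑ r, (∑ i, signedCount s i * boolSign (A r i)) ^ 2 < m / 4 * ∑ i, signedCount s i ^ 2 := by
    intro A _
    obtain ⟨s, hs⟩ := hcon A
    exact mem_biUnion.2 ⟨s, mem_univ s, mem_filter.2 ⟨mem_univ A, hs⟩⟩
  have h2 := (card_le_card h1).trans card_biUnion_le
  have h3 : ((2 : ℝ) ^ N) ^ m ≤ Fintype.card (Sym (Fin N × Bool) k) *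
      ((2 ^ N) ^ m * Real.exp (-(m / 20))) := by
    calc ((2 : ℝ) ^ N) ^ m = ((univ : Finset (Fin m → Fin N → Bool)).card : ℝ) := by simp
      _ ≤ ∑ s : Sym (Fin N × Bool) k, ((univ.filter fun A : Fin m → Fin N → Bool =>
          ∑ r, (∑ i, signedCount s i * boolSign (A r i)) ^ 2 <
            m / 4 * ∑ i, signedCount s i ^ 2).card : ℝ) := by exact_mod_cast h2
      _ ≤ ∑ s : Sym (Fin N × Bool) k, ((2 ^ N) ^ m * Real.exp (-(m / 20))) :=
          sum_le_sum fun s _ => card_signs_lt_le m _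
      _ = _ := by rw [sum_const, nsmul_eq_mul, card_univ]
  have h4 : (0 : ℝ) < (2 ^ N) ^ m := by positivity
  nlinarith

/-! ### Duality -/

/-- If `V^⊥` carries a bound of the `ℓ_2` norm by the `ℓ_1` norm, then `V` approximates
the Euclidean ball uniformly. -/
lemma exists_mem_norm_sub_le {N : ℕ} (V : Submodule ℝ (Fin N → ℝ)) {δ : ℝ}
    (hV : ∀ y : Fin N → ℝ, (∀ v ∈ V, ∑ i, y i * v i = 0) → ∑ i, |y i| = 1 →
      √(∑ i, y i ^ 2) ≤ δ) (hδ : 0 ≤ δ) (x : Fin N → ℝ) {ε : ℝ} (hε : 0 < ε) :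
    ∃ v ∈ V, ‖x - v‖ ≤ δ * √(∑ i, x i ^ 2) + ε := by
  obtain ⟨g, hg1, hgx⟩ := exists_dual_vector'' ℝ (V.mkQ x)
  have hbound : ‖V.mkQ x‖ ≤ δ * √(∑ i, x i ^ 2) := by
    set f : (Fin N → ℝ) →ₗ[ℝ] ℝ := g.toLinearMap.comp V.mkQ with hf
    set y : Fin N → ℝ := fun i => f (Pi.single i 1) with hy
    have hfy : ∀ z, f z = ∑ i, y i * z i := by
      intro z
      rw [LinearMap.pi_apply_eq_sum_univ f z]
      refine sum_congr rfl fun i _ => ?_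
      rw [smul_eq_mul, mul_comm, hy]
      congr 2
      ext j
      simp [Pi.single_apply, eq_comm]
    have hfle : ∀ z, f z ≤ ‖z‖ := by
      intro z
      calc f z ≤ ‖g (V.mkQ z)‖ := le_abs_self _
        _ ≤ ‖g‖ * ‖V.mkQ z‖ := g.le_opNorm _
        _ ≤ 1 * ‖z‖ := by
            gcongr
            exact Submodule.Quotient.norm_mk_le V z
        _ = ‖z‖ := one_mul _
    have hfV : ∀ v ∈ V, ∑ i, y i * v i = 0 := by
      intro v hv
      rw [← hfy, hf, LinearMap.comp_apply, Submodule.mkQ_apply,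
        (Submodule.Quotient.mk_eq_zero V).2 hv, map_zero]
    have hy1 : ∑ i, |y i| ≤ 1 := by
      calc ∑ i, |y i| = f fun i => SignType.sign (y i) := by
            rw [hfy]
            exact sum_congr rfl fun i _ => (self_mul_sign _).symm
        _ ≤ _ := hfle _
        _ ≤ 1 := (pi_norm_le_iff_of_nonneg zero_le_one).2 fun i => by
            rcases lt_trichotomy (y i) 0 with h | h | h <;> simp [h]
    have hfx : f x = ‖V.mkQ x‖ := hgx
    have hy2 : √(∑ i, y i ^ 2) ≤ δ := by
      rcases (sum_nonneg fun i _ => abs_nonneg (y i) : 0 ≤ ∑ i, |y i|).eq_or_lt with h0 | h0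
      · have : ∀ i, y i = 0 := fun i =>
          abs_eq_zero.1 ((sum_eq_zero_iff_of_nonneg fun i _ => abs_nonneg _).1 h0.symm i (mem_univ i))
        simpa [this] using hδ
      · set c := ∑ i, |y i| with hc
        have h1 := hV (fun i => c⁻¹ * y i)
          (fun v hv => by simp only [mul_assoc, ← mul_sum, hfV v hv, mul_zero])
          (by simp only [abs_mul, ← mul_sum, ← hc, abs_of_pos (inv_pos.2 h0)]
              exact inv_mul_cancel₀ h0.ne')
        simp only [mul_pow, ← mul_sum] at h1
        rw [Real.sqrt_mul (sq_nonneg _), Real.sqrt_sq (inv_pos.2 h0).le,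
          inv_mul_le_iff₀ h0] at h1
        nlinarith
    rw [← hfx, hfy]
    calc ∑ i, y i * x i ≤ √(∑ i, y i ^ 2) * √(∑ i, x i ^ 2) := Real.sum_mul_le_sqrt_mul_sqrt _ _ _
      _ ≤ _ := by gcongr
  obtain ⟨z, hz, hzn⟩ := Submodule.Quotient.norm_mk_lt (V.mkQ x) hε
  refine ⟨x - z, ?_, ?_⟩
  · rw [← Submodule.Quotient.mk_eq_zero, Submodule.Quotient.mk_sub, hz]
    simp
  · rw [sub_sub_cancel]
    linarith

lemma exists_subspace_l2 {m N k : ℕ} (hm : 0 < m) (hk : 0 < k)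
    (h : (Fintype.card (Sym (Fin N × Bool) k) : ℝ) * Real.exp (-(m / 20)) < 1) :
    ∃ V : Submodule ℝ (Fin N → ℝ), finrank ℝ V ≤ m ∧ ∀ (x : Fin N → ℝ) (ε : ℝ), 0 < ε →
      ∃ v ∈ V, ‖x - v‖ ≤ √(16 / k) * √(∑ i, x i ^ 2) + ε := by
  obtain ⟨A, hA⟩ := exists_good_signs h
  have hk' : (0 : ℝ) < k := by exact_mod_cast hk
  set rows : Fin m → Fin N → ℝ := fun r i => boolSign (A r i) with hrows
  refine ⟨Submodule.span ℝ (Set.range rows), ?_, fun x ε hε =>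
    exists_mem_norm_sub_le _ (fun y hy hy1 => ?_) (Real.sqrt_nonneg _) x hε⟩
  · exact (finrank_range_le_card (R := ℝ) rows).trans_eq (Fintype.card_fin m)
  · refine Real.sqrt_le_sqrt ?_
    rw [le_div_iff₀ hk', mul_comm]
    exact l2_le_l1_of_mem_ker hm hA
      (fun r => hy (rows r) (Submodule.subset_span ⟨r, rfl⟩)) hy1

lemma card_sym_mul_exp_lt_one {m N k : ℕ} (hm : 0 < m) (hmN : m ≤ N) (hk : 0 < k)
    (hkle : (k : ℝ) ≤ m / (1000 * Real.log (1 + (N : ℝ) / m))) :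
    (Fintype.card (Sym (Fin N × Bool) k) : ℝ) * Real.exp (-(m / 20)) < 1 := by
  have hm' : (0 : ℝ) < m := by exact_mod_cast hm
  have hk' : (0 : ℝ) < k := by exact_mod_cast hk
  set x : ℝ := (N : ℝ) / m with hx
  have hx1 : 1 ≤ x := (one_le_div hm').2 (by exact_mod_cast hmN)
  have hN : (N : ℝ) = x * m := by rw [hx]; field_simp
  set L := Real.log (1 + x) with hL
  have hL2 : 0.69 ≤ L := by
    have := Real.log_two_gt_d9
    have h2 : Real.log 2 ≤ L := Real.log_le_log (by norm_num) (by linarith)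
    linarith
  have hLx : L ≤ x := by
    have := Real.log_le_sub_one_of_pos (x := 1 + x) (by linarith)
    linarith
  set y : ℝ := m / (1000 * L) with hy
  have hy0 : 0 < y := by positivity
  have hyL : y * L = m / 1000 := by rw [hy]; field_simp
  have hym : y ≤ m := by nlinarith
  have hkN : k ≤ N := by
    have : (k : ℝ) ≤ N := by nlinarith
    exact_mod_cast this
  set z : ℝ := 3 * N / y with hz
  have hzy : 3 * N = z * y := by rw [hz]; field_simp
  have hz1 : 1 ≤ z := by
    rw [hz, one_le_div hy0]
    nlinarith
  have hz2 : z ≤ 3000 * (1 + x) ^ 2 := by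
    have : z = 3000 * (x * L) := by rw [hz, hy, hN]; field_simp; ring
    rw [this]
    nlinarith
  have hlogz : Real.log z ≤ 9 + 2 * L := by
    have h1 : Real.log z ≤ Real.log 3000 + 2 * L := by
      refine (Real.log_le_log (by linarith) hz2).trans (le_of_eq ?_)
      rw [Real.log_mul (by norm_num) (by positivity), Real.log_pow, hL]
      norm_num
    have h2 : Real.log 3000 ≤ 9 := by
      rw [Real.log_le_iff_le_exp (by norm_num)]
      have h3 : Real.exp 9 = Real.exp 1 ^ 9 := by rw [← Real.exp_nat_mul]; norm_num
      have h4 : (2.7 : ℝ) ^ 9 ≤ Real.exp 1 ^ 9 :=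
        pow_le_pow_left₀ (by norm_num) (by linarith [Real.exp_one_gt_d9]) _
      rw [h3]
      norm_num at h4 ⊢
      linarith
    linarith
  have hcard : (Fintype.card (Sym (Fin N × Bool) k) : ℝ) ≤ Real.exp (y * Real.log z + y) := by
    rw [Sym.card_sym_eq_choose, Fintype.card_prod, Fintype.card_fin, Fintype.card_bool]
    calc ((N * 2 + k - 1).choose k : ℝ) ≤ ((N * 2 + k - 1 : ℕ) : ℝ) ^ k / k.factorial :=
          Nat.choose_le_pow_div _ _
      _ ≤ (3 * N : ℝ) ^ k / k.factorial := by
          gcongr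
          have : N * 2 + k - 1 ≤ 3 * N := by omega
          exact_mod_cast this
      _ = z ^ k * (y ^ k / k.factorial) := by rw [hzy, mul_pow]; ring
      _ ≤ z ^ y * Real.exp y := by
          gcongr
          · rw [← Real.rpow_natCast]
            exact Real.rpow_le_rpow_of_exponent_le hz1 hkle
          · exact Real.pow_div_factorial_le_exp y hy0.le k
      _ = _ := by rw [Real.exp_add, Real.rpow_def_of_pos (by linarith), mul_comm y]
  calc _ ≤ Real.exp (y * Real.log z + y) * Real.exp (-(m / 20)) := by gcongr
    _ = Real.exp (y * Real.log z + y - m / 20) := by rw [← Real.exp_add]; ring_nf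
    _ < 1 := by
        rw [Real.exp_lt_one_iff]
        have h1 : y * Real.log z ≤ y * (9 + 2 * L) := by gcongr
        nlinarith

/-! ### Truncation -/

lemma sub_le_mul_rpow {q s : ℝ} (hq : 1 ≤ q) (hs : 1 ≤ s) : s - 1 ≤ 1 / q * s ^ q := by
  have h := one_add_mul_self_le_rpow_one_add (s := s - 1) (by linarith) hq
  rw [add_sub_cancel] at h
  rw [one_div, ← div_eq_inv_mul, le_div_iff₀ (by linarith)]
  linarith

lemma exists_truncation {p t : ℝ} (hp : 2 ≤ p) (ht : 0 < t) {N : ℕ} (x : Fin N → ℝ)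
    (hx : ∑ i, |x i| ^ p ≤ 1) :
    ∃ z : Fin N → ℝ, ‖z‖ ≤ t ∧ √(∑ i, (x i - z i) ^ 2) ≤ 2 / p * t / t ^ (p / 2) := by
  have hb : 0 < 2 / p * t / t ^ (p / 2) := by positivity
  have hmem : ∀ i, |max (-t) (min t (x i))| ≤ t := fun i => by
    rw [abs_le]
    exact ⟨le_max_left _ _, max_le (by linarith) (min_le_left _ _)⟩
  refine ⟨fun i => max (-t) (min t (x i)),
    (pi_norm_le_iff_of_nonneg ht.le).2 hmem, Real.sqrt_le_iff.2 ⟨hb.le, ?_⟩⟩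
  have habs : ∀ i, |x i - max (-t) (min t (x i))| ≤ 2 / p * t / t ^ (p / 2) * |x i| ^ (p / 2) := by
    intro i
    rcases le_or_gt |x i| t with h | h
    · rw [abs_le] at h
      rw [min_eq_right h.2, max_eq_right h.1, sub_self, abs_zero]
      positivity
    · have h1 : |x i - max (-t) (min t (x i))| = |x i| - t := by
        rcases lt_abs.1 h with h | h
        · rw [min_eq_left h.le, max_eq_right (by linarith), abs_of_pos (by linarith),
            abs_of_pos (by linarith)]
        · rw [min_eq_right (by linarith), max_eq_left (by linarith), abs_of_neg (by linarith),
            abs_of_neg (by linarith)]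
          ring
      have h2 := sub_le_mul_rpow (q := p / 2) (s := |x i| / t) (by linarith)
        ((one_le_div ht).2 h.le)
      rw [Real.div_rpow (abs_nonneg _) ht.le, one_div_div] at h2
      rw [h1]
      calc |x i| - t = t * (|x i| / t - 1) := by field_simp
        _ ≤ t * (2 / p * (|x i| ^ (p / 2) / t ^ (p / 2))) := by gcongr
        _ = _ := by ring
  have hsq : ∀ i, (x i - max (-t) (min t (x i))) ^ 2 ≤
      (2 / p * t / t ^ (p / 2)) ^ 2 * |x i| ^ p := by
    intro i
    rw [← sq_abs]
    refine (pow_le_pow_left₀ (abs_nonneg _) (habs i) 2).trans (le_of_eq ?_)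
    rw [mul_pow, ← Real.rpow_mul_natCast (abs_nonneg _)]
    norm_num
  calc _ ≤ ∑ i, (2 / p * t / t ^ (p / 2)) ^ 2 * |x i| ^ p := sum_le_sum fun i _ => hsq i
    _ ≤ _ := by
        rw [← mul_sum]
        exact mul_le_of_le_one_right (sq_nonneg _) hx

lemma kolmogorovNumber_le_of_l2 {p b : ℝ} (hp : 2 ≤ p) (hb : 0 < b) {N n : ℕ}
    (V : Submodule ℝ (Fin N → ℝ)) (hV : finrank ℝ V < n)
    (h : ∀ (x : Fin N → ℝ) (ε : ℝ), 0 < ε →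
      ∃ v ∈ V, ‖x - v‖ ≤ √b * √(∑ i, x i ^ 2) + ε) :
    kolmogorovNumber (ENNReal.ofReal p) ∞ N n ≤ (8 * b) ^ (1 / p) := by
  have hp0 : 0 < p := by linarith
  refine kolmogorovNumber_le hp0 (by positivity) V hV fun x hx ε hε => ?_
  set t := b ^ (1 / p) with ht
  have ht0 : 0 < t := by positivity
  have htp : t ^ (p / 2) = √b := by
    rw [ht, ← Real.rpow_mul hb.le, Real.sqrt_eq_rpow]
    congr 1
    field_simp
  obtain ⟨z, hz, hxz⟩ := exists_truncation hp ht0 x hx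
  obtain ⟨v, hv, hvz⟩ := h (x - z) ε hε
  refine ⟨v, hv, ?_⟩
  have hb' : 0 < √b := Real.sqrt_pos.2 hb
  have h1 : √b * √(∑ i, (x - z) i ^ 2) ≤ 2 / p * t := by
    calc √b * √(∑ i, (x - z) i ^ 2) ≤ √b * (2 / p * t / t ^ (p / 2)) := by
          gcongr
          exact hxz
      _ = _ := by rw [htp]; field_simp
  have h2 : ‖x - v‖ ≤ ‖z‖ + ‖x - z - v‖ := by
    refine le_trans (le_of_eq ?_) (norm_add_le _ _)
    congr 1
    abel
  have h3 : t * (1 + 2 / p) ≤ (8 * b) ^ (1 / p) := by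
    rw [Real.mul_rpow (by norm_num) hb.le, ← ht, mul_comm]
    gcongr
    have h8 : Real.exp 2 ≤ 8 := by
      have h2 : Real.exp 2 = Real.exp 1 ^ 2 := by rw [← Real.exp_nat_mul]; norm_num
      rw [h2]
      nlinarith [Real.exp_one_lt_d9, Real.exp_pos 1]
    calc 1 + 2 / p ≤ Real.exp (2 / p) := by linarith [Real.add_one_le_exp (2 / p)]
      _ = Real.exp 2 ^ (1 / p) := by rw [← Real.exp_mul]; ring_nf
      _ ≤ 8 ^ (1 / p) := by gcongr
  linarith

lemma kolmogorovNumber_upper {p : ℝ} (hp : 2 ≤ p) {N n : ℕ} (hn : 2 ≤ n) (hnN : n ≤ N) :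
    kolmogorovNumber (ENNReal.ofReal p) ∞ N n ≤
      min 1 ((256000 * Real.log (1 + (N : ℝ) / ((n : ℝ) - 1)) / ((n : ℝ) - 1)) ^ (1 / p)) := by
  obtain ⟨m, rfl⟩ : ∃ m, n = m + 1 := ⟨n - 1, by omega⟩
  have hm : 0 < m := by omega
  have hm' : (0 : ℝ) < m := by exact_mod_cast hm
  have hmN : (m : ℝ) < N := by exact_mod_cast hnN
  have hp0 : 0 < p := by linarith
  have hcast : (((m + 1 : ℕ) : ℝ) - 1) = m := by push_cast; ring
  rw [hcast]
  have hx1 : 1 < (N : ℝ) / m := (one_lt_div hm').2 hmN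
  have hL0 : 0 < Real.log (1 + (N : ℝ) / m) := Real.log_pos (by linarith)
  have hone : kolmogorovNumber (ENNReal.ofReal p) ∞ N (m + 1) ≤ 1 := by
    refine kolmogorovNumber_le hp0 zero_le_one ⊥ (by simp) fun x hx ε hε => ⟨0, by simp, ?_⟩
    rw [sub_zero]
    linarith [norm_le_one_of_sum_rpow_le_one hp0 hx]
  refine le_min hone ?_
  have hcard := card_sym_mul_exp_lt_one hm (N := N) (k := ⌊m / (1000 * Real.log (1 + (N : ℝ) / m))⌋₊)
    (by omega)
  set L := Real.log (1 + (N : ℝ) / m)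
  set y : ℝ := m / (1000 * L) with hy
  have hy0 : 0 < y := by positivity
  have hyL : y * L = m / 1000 := by rw [hy]; field_simp
  rcases lt_or_ge y 1 with h | h
  · refine hone.trans (Real.one_le_rpow ?_ (by positivity))
    rw [one_le_div hm']
    nlinarith
  · have hk : 0 < ⌊y⌋₊ := Nat.floor_pos.2 h
    have hk' : (0 : ℝ) < ⌊y⌋₊ := by exact_mod_cast hk
    have hk1 : (1 : ℝ) ≤ ⌊y⌋₊ := by exact_mod_cast hk
    obtain ⟨V, hV, hVx⟩ := exists_subspace_l2 hm hk (hcard hk (Nat.floor_le hy0.le))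
    refine (kolmogorovNumber_le_of_l2 hp (by positivity) V (by omega) hVx).trans ?_
    refine Real.rpow_le_rpow (by positivity) ?_ (by positivity)
    have h1 : y ≤ 2 * ⌊y⌋₊ := by linarith [Nat.lt_floor_add_one y]
    rw [mul_div_assoc', div_le_div_iff₀ hk' hm']
    nlinarith

end KolmogorovWidth

/-- For `2 ≤ p < ∞` there are absolute constants `c₁, c₂ > 0` such that for all
`2 ≤ n ≤ N`, `(1/4)·min{1, (c₁·log(1+N/(n-1))/(n-1))^{1/p}} ≤ d_n(id : ℓ_p^N → ℓ_∞^N)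
≤ min{1, (c₂·log(1+N/(n-1))/(n-1))^{1/p}}`. -/
theorem kolmogorov_lp_linfty_two_sided :
    ∃ c₁ c₂ : ℝ, 0 < c₁ ∧ 0 < c₂ ∧
      ∀ p : ℝ, 2 ≤ p → ∀ N n : ℕ, 2 ≤ n → n ≤ N →
        (1/4 : ℝ) *
            min 1 ((c₁ * Real.log (1 + (N : ℝ) / ((n : ℝ) - 1)) / ((n : ℝ) - 1)) ^ (1/p))
          ≤ kolmogorovNumber (ENNReal.ofReal p) ∞ N n ∧
        kolmogorovNumber (ENNReal.ofReal p) ∞ N n ≤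
          min 1 ((c₂ * Real.log (1 + (N : ℝ) / ((n : ℝ) - 1)) / ((n : ℝ) - 1)) ^ (1/p)) :=
  ⟨1 / 100, 256000, by norm_num, by norm_num, fun _ hp _ _ hn hnN =>
    ⟨KolmogorovWidth.kolmogorovNumber_lower (by linarith) hn hnN,
      KolmogorovWidth.kolmogorovNumber_upper hp hn hnN⟩⟩
end

section
/- Let 0 < p₁ ≤ 1 and 2 < p₂ ≤ ∞. Then there exist constants C₁, C₂ > 0 depending only on p₁ and p₂ such that for all N, n ∈ ℕ with 2 ≤ n ≤ N, the n-th Gelfand number of the identity map from ℓ_{p₁}^N to ℓ_{p₂}^N satisfies C₁ · min{ 1, (ln(N/(n−1)) + 1)/(n−1) }^{1/p₁ − 1/p₂} ≤ c_n(id : ℓ_{p₁}^N → ℓ_{p₂}^N) ≤ C₂ · min{ 1, (ln(N/(n−1)) + 1)/(n−1) }^{1/p₁ − 1/2}, where 1/∞ is interpreted as 0. -/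
open scoped ENNReal BigOperators

namespace GelfandWidth

/-- The sign `±1` attached to a Boolean. -/
def boolSign (b : Bool) : ℝ := if b then 1 else -1

/-- The Rademacher form `∑ j, ± x j` with signs `a`. -/
def signForm {N : ℕ} (a : Fin N → Bool) (x : Fin N → ℝ) : ℝ := ∑ j, boolSign (a j) * x j

section Symmetrization

variable {Ω ι : Type*} [Fintype Ω] [Nonempty Ω] [Finite ι] [Nonempty ι]

/-- Symmetrization and contraction for a single row. -/
lemma sum_iSup_sub_abs_le (φ : Ω → ι → ℝ) (ν : Ω ≃ Ω) (hν : ∀ a x, φ (ν a) x = -φ a x)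
    (f : ι → ℝ) (hf : ∀ x, (Fintype.card Ω : ℝ) * f x = ∑ a, |φ a x|) (h : ι → ℝ) :
    ∑ a, ⨆ x, (h x + (f x - |φ a x|)) ≤ ∑ a, ⨆ x, (h x + 2 * φ a x) := by
  have bdd : ∀ g : ι → ℝ, BddAbove (Set.range g) := fun g => (Set.finite_range g).bddAbove
  set Sp : Ω → ℝ := fun a => ⨆ x, (h x + 2 * |φ a x|) with hSp
  set Sm : Ω → ℝ := fun a => ⨆ x, (h x - 2 * |φ a x|) with hSm
  set S : Ω → ℝ := fun a => ⨆ x, (h x + 2 * φ a x) with hS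
  have hc : (0 : ℝ) < Fintype.card Ω := by exact_mod_cast Fintype.card_pos
  have step1 : ∀ a, ⨆ x, (h x + (f x - |φ a x|)) ≤
      Sm a / 2 + (∑ b, Sp b) / (2 * Fintype.card Ω) := by
    intro a
    refine ciSup_le fun x => ?_
    have h1 : h x - 2 * |φ a x| ≤ Sm a := le_ciSup (f := fun x => h x - 2 * |φ a x|) (bdd _) x
    have h2 : (Fintype.card Ω : ℝ) * h x + 2 * (Fintype.card Ω * f x) ≤ ∑ b, Sp b := by
      rw [hf, Finset.mul_sum]
      calc _ = ∑ b, (h x + 2 * |φ b x|) := by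
            rw [Finset.sum_add_distrib]; simp
        _ ≤ _ := Finset.sum_le_sum fun b _ =>
            le_ciSup (f := fun x => h x + 2 * |φ b x|) (bdd _) x
    have h3 : h x / 2 + f x ≤ (∑ b, Sp b) / (2 * Fintype.card Ω) := by
      rw [le_div_iff₀ (by positivity)]
      nlinarith
    linarith
  have step2 : ∀ a, Sp a + Sm a ≤ S a + S (ν a) := by
    intro a
    have key : ∀ x y, h x + 2 * |φ a x| + (h y - 2 * |φ a y|) ≤ S a + S (ν a) := by
      intro x y
      have a1 : ∀ z, h z + 2 * φ a z ≤ S a := le_ciSup (f := fun x => h x + 2 * φ a x) (bdd _)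
      have a2 : ∀ z, h z + 2 * φ (ν a) z ≤ S (ν a) :=
        le_ciSup (f := fun x => h x + 2 * φ (ν a) x) (bdd _)
      have e1 := a1 x
      have e2 := a1 y
      have e3 := a2 x
      have e4 := a2 y
      rw [hν] at e3 e4
      have := abs_sub_abs_le_abs_sub (φ a x) (φ a y)
      rcases abs_cases (φ a x - φ a y) with h' | h' <;> linarith
    have : Sp a ≤ S a + S (ν a) - Sm a := by
      refine ciSup_le fun x => ?_
      have : Sm a ≤ S a + S (ν a) - (h x + 2 * |φ a x|) :=
        ciSup_le fun y => by linarith [key x y]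
      linarith
    linarith
  have step3 : ∑ a, S (ν a) = ∑ a, S a := Equiv.sum_comp ν S
  have t1 := Finset.sum_le_sum fun a (_ : a ∈ Finset.univ) => step1 a
  have t2 := Finset.sum_le_sum fun a (_ : a ∈ Finset.univ) => step2 a
  rw [Finset.sum_add_distrib, Finset.sum_add_distrib, step3] at t2
  rw [Finset.sum_add_distrib, ← Finset.sum_div, Finset.sum_const, Finset.card_univ,
    nsmul_eq_mul] at t1
  have : (Fintype.card Ω : ℝ) * ((∑ b, Sp b) / (2 * Fintype.card Ω)) = (∑ b, Sp b) / 2 := by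
    field_simp
  linarith

lemma sum_fin_succ_pi {Ω : Type*} [Fintype Ω] {m : ℕ} (g : (Fin (m + 1) → Ω) → ℝ) :
    ∑ A, g A = ∑ a : Ω, ∑ A : Fin m → Ω, g (Fin.cons a A) := by
  rw [← Fintype.sum_prod_type']
  exact (Fintype.sum_equiv (Fin.consEquiv fun _ => Ω) _ _ fun _ => rfl).symm

/-- Symmetrization and contraction for independent rows. -/
lemma sum_iSup_sum_sub_abs_le (φ : Ω → ι → ℝ) (ν : Ω ≃ Ω) (hν : ∀ a x, φ (ν a) x = -φ a x)
    (f : ι → ℝ) (hf : ∀ x, (Fintype.card Ω : ℝ) * f x = ∑ a, |φ a x|) (m : ℕ) (h : ι → ℝ) :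
    ∑ A : Fin m → Ω, ⨆ x, (h x + ∑ i, (f x - |φ (A i) x|)) ≤
      ∑ A : Fin m → Ω, ⨆ x, (h x + ∑ i, 2 * φ (A i) x) := by
  induction m generalizing h with
  | zero => simp
  | succ m ih =>
    rw [sum_fin_succ_pi, sum_fin_succ_pi]
    simp only [Fin.sum_univ_succ, Fin.cons_zero, Fin.cons_succ, ← add_assoc]
    refine (Finset.sum_le_sum fun a _ => ih _).trans ?_
    rw [Finset.sum_comm, Finset.sum_comm (s := Finset.univ (α := Ω))]
    refine Finset.sum_le_sum fun A _ => ?_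
    have := sum_iSup_sub_abs_le φ ν hν f hf (fun x => h x + ∑ i, 2 * φ (A i) x)
    refine le_of_eq_of_le ?_ (this.trans_eq ?_) <;>
    · refine Finset.sum_congr rfl fun a _ => ?_
      congr 1; ext x; ring

end Symmetrization

section Rademacher

lemma boolSign_not (b : Bool) : boolSign (!b) = -boolSign b := by
  cases b <;> simp [boolSign]

/-- Negation of all signs. -/
def negEquiv (N : ℕ) : (Fin N → Bool) ≃ (Fin N → Bool) where
  toFun a j := !a j
  invFun a j := !a j
  left_inv a := by ext; simp
  right_inv a := by ext; simp

lemma signForm_neg {N : ℕ} (a : Fin N → Bool) (x : Fin N → ℝ) :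
    signForm (negEquiv N a) x = -signForm a x := by
  simp [signForm, negEquiv, boolSign_not]

lemma signForm_moments (N : ℕ) (x : Fin N → ℝ) :
    ∑ a, signForm a x ^ 2 = 2 ^ N * ∑ j, x j ^ 2 ∧
      ∑ a, signForm a x ^ 4 ≤ 2 ^ N * (3 * (∑ j, x j ^ 2) ^ 2) := by
  induction N with
  | zero => simp [signForm]
  | succ N ih =>
    obtain ⟨i2, i4⟩ := ih (Fin.tail x)
    set y := Fin.tail x with hy
    have hs : ∀ (b : Bool) (a : Fin N → Bool),
        signForm (Fin.cons b a : Fin (N + 1) → Bool) x = boolSign b * x 0 + signForm a y := by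
      intro b a
      simp [signForm, Fin.sum_univ_succ, hy, Fin.tail]
    have hR : ∑ j, x j ^ 2 = x 0 ^ 2 + ∑ j, y j ^ 2 := by
      simp [Fin.sum_univ_succ, hy, Fin.tail]
    set R := ∑ j, y j ^ 2
    have hR0 : 0 ≤ R := Finset.sum_nonneg fun _ _ => sq_nonneg _
    constructor
    · rw [sum_fin_succ_pi, Fintype.sum_bool, ← Finset.sum_add_distrib]
      simp only [hs]
      have : ∀ a, (boolSign true * x 0 + signForm a y) ^ 2 +
          (boolSign false * x 0 + signForm a y) ^ 2
          = 2 * x 0 ^ 2 + 2 * signForm a y ^ 2 := by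
        intro a; simp only [boolSign, if_true, Bool.false_eq_true, if_false]; ring
      simp only [this, Finset.sum_add_distrib, ← Finset.mul_sum, i2, hR]
      simp
      ring
    · rw [sum_fin_succ_pi, Fintype.sum_bool, ← Finset.sum_add_distrib]
      simp only [hs]
      have : ∀ a, (boolSign true * x 0 + signForm a y) ^ 4 +
          (boolSign false * x 0 + signForm a y) ^ 4
          = 2 * x 0 ^ 4 + 12 * x 0 ^ 2 * signForm a y ^ 2 + 2 * signForm a y ^ 4 := by
        intro a; simp only [boolSign, if_true, Bool.false_eq_true, if_false]; ring
      simp only [this, Finset.sum_add_distrib, ← Finset.mul_sum, i2, hR]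
      simp
      have : (0:ℝ) ≤ 2 ^ N * (x 0 ^ 4) := by positivity
      rw [pow_succ (2 : ℝ) N]
      nlinarith

/-- A Khinchine inequality. -/
lemma card_mul_le_sum_abs_signForm {N : ℕ} (x : Fin N → ℝ) {R : ℝ} (hR : 0 < R)
    (hx : ∑ j, x j ^ 2 = R ^ 2) : 2 ^ N * (R / 2) ≤ ∑ a, |signForm a x| := by
  obtain ⟨i2, i4⟩ := signForm_moments N x
  rw [hx] at i2 i4
  have pt : ∀ t : ℝ, 0 ≤ t → t ^ 2 * R ^ 2 - 4 / 27 * t ^ 4 ≤ t * R ^ 3 := by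
    intro t ht
    have : 0 ≤ t * ((2 * t - 3 * R) ^ 2 * (t + 3 * R)) := by positivity
    nlinarith
  have h1 : ∑ a, (signForm a x ^ 2 * R ^ 2 - 4 / 27 * signForm a x ^ 4) ≤
      ∑ a, |signForm a x| * R ^ 3 := by
    refine Finset.sum_le_sum fun a _ => ?_
    have := pt |signForm a x| (abs_nonneg _)
    rwa [sq_abs, show |signForm a x| ^ 4 = signForm a x ^ 4 by
      rw [show 4 = 2 * 2 by rfl, pow_mul, pow_mul, sq_abs]] at this
  rw [Finset.sum_sub_distrib, ← Finset.sum_mul, ← Finset.mul_sum, ← Finset.sum_mul, i2] at h1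
  have h2 : (2 ^ N * (R / 2)) * R ^ 3 ≤ (∑ a, |signForm a x|) * R ^ 3 := by
    have : (0:ℝ) ≤ 2 ^ N * R ^ 4 := by positivity
    nlinarith
  exact le_of_mul_le_mul_right h2 (by positivity)

/-- The moment generating function of a column sum of a random sign matrix. -/
lemma sum_exp_column_le (m N : ℕ) (j : Fin N) (c : ℝ) :
    ∑ A : Fin m → Fin N → Bool, Real.exp (c * ∑ i, boolSign (A i j)) ≤
      (2 ^ N) ^ m * Real.exp (m * (c ^ 2 / 2)) := by
  have h1 : ∑ a : Fin N → Bool, Real.exp (c * boolSign (a j)) = 2 ^ N * Real.cosh c := by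
    have hh := (Finset.prod_univ_sum (fun _ : Fin N => (Finset.univ : Finset Bool))
      (fun k b => if k = j then Real.exp (c * boolSign b) else 1)).symm
    rw [Fintype.piFinset_univ] at hh
    have e1 : ∀ a : Fin N → Bool, ∏ k, (if k = j then Real.exp (c * boolSign (a k)) else 1)
        = Real.exp (c * boolSign (a j)) := by
      intro a; simp
    have e2 : ∀ k : Fin N, (∑ b : Bool, if k = j then Real.exp (c * boolSign b) else 1)
        = 2 * (if k = j then Real.cosh c else 1) := by
      intro k
      split_ifs <;> simp [boolSign, Real.cosh_eq]
      ring
    simp only [e1, e2] at hh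
    rw [hh, Finset.prod_mul_distrib]
    simp
  calc _ = ∑ A : Fin m → Fin N → Bool, ∏ i, Real.exp (c * boolSign (A i j)) := by
        refine Finset.sum_congr rfl fun A _ => ?_
        rw [Finset.mul_sum, Real.exp_sum]
    _ = (2 ^ N * Real.cosh c) ^ m := by
        rw [← h1, Fintype.sum_pow]
    _ ≤ (2 ^ N * Real.exp (c ^ 2 / 2)) ^ m := by
        have := Real.cosh_le_exp_half_sq c
        have h0 := (Real.cosh_pos c).le
        gcongr
    _ = _ := by rw [mul_pow, ← Real.exp_nat_mul]

end Rademacher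

section Kernel

lemma truncated_sq_le {c : ℝ} (hc : 0 < c) (τ g : ℝ) :
    max (|g| - τ) 0 ^ 2 ≤
      2 / c ^ 2 * Real.exp (-(c * τ)) * (Real.exp (c * g) + Real.exp (-c * g)) := by
  have h1 : Real.exp (c * |g|) ≤ Real.exp (c * g) + Real.exp (-c * g) := by
    rcases abs_cases g with h | h <;> rw [h.1]
    · linarith [Real.exp_pos (-c * g)]
    · rw [mul_neg, ← neg_mul]; linarith [Real.exp_pos (c * g)]
  have h2 : max (|g| - τ) 0 ^ 2 ≤ 2 / c ^ 2 * Real.exp (c * (|g| - τ)) := by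
    rcases le_total (|g| - τ) 0 with h | h
    · rw [max_eq_right h, zero_pow two_ne_zero]; positivity
    · rw [max_eq_left h]
      have := Real.quadratic_le_exp_of_nonneg (mul_nonneg hc.le h)
      rw [div_mul_eq_mul_div, le_div_iff₀ (by positivity)]
      nlinarith [mul_nonneg hc.le h]
  calc _ ≤ _ := h2
    _ = 2 / c ^ 2 * Real.exp (-(c * τ)) * Real.exp (c * |g|) := by
        rw [mul_assoc, ← Real.exp_add]; ring_nf
    _ ≤ _ := by gcongr

lemma two_mul_inner_le {N : ℕ} (G x : Fin N → ℝ) {τ α ρ : ℝ} (hτ : 0 ≤ τ) (hα : 0 < α)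
    (h1 : ∑ j, |x j| ≤ 1) (h2 : ∑ j, x j ^ 2 = ρ ^ 2) :
    2 * ∑ j, G j * x j ≤ 2 * τ + α * ρ ^ 2 + (∑ j, max (|G j| - τ) 0 ^ 2) / α := by
  have pt : ∀ j, 2 * (G j * x j) ≤
      2 * τ * |x j| + α * x j ^ 2 + max (|G j| - τ) 0 ^ 2 / α := by
    intro j
    set w := max (|G j| - τ) 0
    have hw : |G j| ≤ τ + w := by linarith [le_max_left (|G j| - τ) 0]
    have e1 : G j * x j ≤ (τ + w) * |x j| := by
      calc G j * x j ≤ |G j * x j| := le_abs_self _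
        _ = |G j| * |x j| := abs_mul _ _
        _ ≤ _ := by gcongr
    have e2 : 2 * (w * |x j|) ≤ α * x j ^ 2 + w ^ 2 / α := by
      rw [← sq_abs (x j)]
      have : α * |x j| ^ 2 + w ^ 2 / α - 2 * (w * |x j|) = (α * |x j| - w) ^ 2 / α := by
        field_simp; ring
      have : 0 ≤ (α * |x j| - w) ^ 2 / α := by positivity
      linarith
    linarith
  rw [Finset.mul_sum]
  refine (Finset.sum_le_sum fun j _ => pt j).trans ?_
  rw [Finset.sum_add_distrib, Finset.sum_add_distrib, ← Finset.mul_sum, ← Finset.mul_sum,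
    ← Finset.sum_div, h2]
  nlinarith

lemma sum_truncated_column_le {N m : ℕ} {c : ℝ} (hc : 0 < c) (τ : ℝ) :
    ∑ A : Fin m → Fin N → Bool, ∑ j, max (|∑ i, boolSign (A i j)| - τ) 0 ^ 2 ≤
      (2 ^ N) ^ m * (N * (4 / c ^ 2 * Real.exp (m * (c ^ 2 / 2) - c * τ))) := by
  rw [Finset.sum_comm]
  have : ∀ j : Fin N, ∑ A : Fin m → Fin N → Bool, max (|∑ i, boolSign (A i j)| - τ) 0 ^ 2 ≤
      (2 ^ N) ^ m * (4 / c ^ 2 * Real.exp (m * (c ^ 2 / 2) - c * τ)) := by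
    intro j
    refine (Finset.sum_le_sum fun A _ => truncated_sq_le hc τ _).trans ?_
    rw [← Finset.mul_sum, Finset.sum_add_distrib]
    have e1 := sum_exp_column_le m N j c
    have e2 := sum_exp_column_le m N j (-c)
    rw [neg_sq] at e2
    calc _ ≤ 2 / c ^ 2 * Real.exp (-(c * τ)) * ((2 ^ N) ^ m * Real.exp (m * (c ^ 2 / 2)) +
          (2 ^ N) ^ m * Real.exp (m * (c ^ 2 / 2))) := by gcongr
      _ = _ := by rw [sub_eq_add_neg, Real.exp_add]; ring
  refine (Finset.sum_le_sum fun j _ => this j).trans_eq ?_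
  simp
  ring

/-- Some sign matrix has a kernel on which the `ℓ_2` norm is controlled by the `ℓ_1` norm. -/
theorem exists_signMatrix_ker {N m : ℕ} (hm : 1 ≤ m) (hmN : m ≤ N) :
    ∃ A : Fin m → Fin N → Bool, ∀ x : Fin N → ℝ, (∀ i, signForm (A i) x = 0) →
      ∑ j, x j ^ 2 ≤ 32 ^ 2 * ((Real.log (N / m) + 1) / m) * (∑ j, |x j|) ^ 2 := by
  have hm0 : (0 : ℝ) < m := by exact_mod_cast hm
  have hN0 : (0 : ℝ) < N := by exact_mod_cast hm.trans hmN
  set L := Real.log (N / m) + 1 with hL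
  have hL1 : 1 ≤ L := by
    have : 0 ≤ Real.log (N / m) :=
      Real.log_nonneg (by rw [le_div_iff₀ hm0, one_mul]; exact_mod_cast hmN)
    linarith
  have hexpL : N * Real.exp (-L) = m * Real.exp (-1) := by
    rw [hL, neg_add, Real.exp_add, Real.exp_neg, Real.exp_log (by positivity)]
    field_simp
  set ρ := 32 * √(L / m) with hρ
  have hρ0 : 0 < ρ := by positivity
  have hρ2 : ρ ^ 2 = 32 ^ 2 * (L / m) := by
    rw [hρ, mul_pow, Real.sq_sqrt (by positivity)]
  rw [← hρ2]
  by_contra! hcon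
  have hcon' : ∀ A : Fin m → Fin N → Bool, ∃ x : Fin N → ℝ, (∀ i, signForm (A i) x = 0) ∧
      ∑ j, |x j| ≤ 1 ∧ ∑ j, x j ^ 2 = ρ ^ 2 := by
    intro A
    obtain ⟨x, hx, hlt⟩ := hcon A
    set Q := ∑ j, x j ^ 2
    have hQ : 0 < Q := lt_of_le_of_lt (by positivity) hlt
    set κ := ρ / √Q
    have hκ : 0 < κ := by positivity
    have hκ2 : κ ^ 2 * Q = ρ ^ 2 := by
      simp only [κ, div_pow, Real.sq_sqrt hQ.le]; field_simp
    refine ⟨κ • x, fun i => ?_, ?_, ?_⟩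
    · have : signForm (A i) (κ • x) = κ * signForm (A i) x := by
        simp only [signForm, Finset.mul_sum, Pi.smul_apply, smul_eq_mul]
        exact Finset.sum_congr rfl fun _ _ => by ring
      rw [this, hx, mul_zero]
    · have : ∑ j, |(κ • x) j| = κ * ∑ j, |x j| := by
        simp [Finset.mul_sum, abs_mul, abs_of_pos hκ]
      rw [this]
      refine (sq_le_one_iff₀ (by positivity)).1 ?_
      rw [mul_pow]
      have h3 : ρ ^ 2 * (κ ^ 2 * (∑ j, |x j|) ^ 2) ≤ ρ ^ 2 * 1 := by
        rw [mul_one]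
        nlinarith [pow_pos hκ 2]
      exact le_of_mul_le_mul_left h3 (by positivity)
    · simp only [Pi.smul_apply, smul_eq_mul, mul_pow, ← Finset.mul_sum]
      exact hκ2
  choose X hX0 hX1 hX2 using hcon'
  set φ : (Fin N → Bool) → (Fin m → Fin N → Bool) → ℝ := fun a B => signForm a (X B) with hφ
  set f : (Fin m → Fin N → Bool) → ℝ := fun B => (∑ a, |φ a B|) / 2 ^ N with hf
  have hmain := sum_iSup_sum_sub_abs_le φ (negEquiv N) (fun a B => signForm_neg a (X B)) f
    (fun B => by simp [hf]; field_simp) m 0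
  simp only [Pi.zero_apply, zero_add] at hmain
  have hlow : (2 ^ N) ^ m * (m * (ρ / 2)) ≤
      ∑ A : Fin m → Fin N → Bool, ⨆ B, ∑ i, (f B - |φ (A i) B|) := by
    have : ∀ A : Fin m → Fin N → Bool, m * (ρ / 2) ≤ ⨆ B, ∑ i, (f B - |φ (A i) B|) := by
      intro A
      refine le_trans ?_ (le_ciSup (Set.finite_range _).bddAbove A)
      have e1 : ρ / 2 ≤ f A := by
        simp only [hf]
        rw [le_div_iff₀ (by positivity), mul_comm]
        exact card_mul_le_sum_abs_signForm (X A) hρ0 (hX2 A)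
      simp only [hφ, hX0]
      simp
      gcongr
    calc _ = ∑ A : Fin m → Fin N → Bool, m * (ρ / 2) := by simp
      _ ≤ _ := Finset.sum_le_sum fun A _ => this A
  set τ := √(8 * m * L) with hτ
  have hτ2 : τ ^ 2 = 8 * m * L := Real.sq_sqrt (by positivity)
  have hτ0 : 0 < τ := by positivity
  set α := m / (8 * ρ) with hα
  have hα0 : 0 < α := by positivity
  set c := τ / m with hc
  have hc0 : 0 < c := by positivity
  have hup : ∑ A : Fin m → Fin N → Bool, ⨆ B, ∑ i, 2 * φ (A i) B ≤
      (2 ^ N) ^ m * (2 * τ + α * ρ ^ 2 +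
        (N * (4 / c ^ 2 * Real.exp (m * (c ^ 2 / 2) - c * τ))) / α) := by
    have : ∀ A : Fin m → Fin N → Bool, ⨆ B, ∑ i, 2 * φ (A i) B ≤ 2 * τ + α * ρ ^ 2 +
        (∑ j, max (|∑ i, boolSign (A i j)| - τ) 0 ^ 2) / α := by
      intro A
      refine ciSup_le fun B => ?_
      refine le_of_eq_of_le ?_ (two_mul_inner_le _ _ hτ0.le hα0 (hX1 B) (hX2 B))
      simp only [hφ, signForm, ← Finset.mul_sum, Finset.sum_mul]
      rw [Finset.sum_comm]
    refine (Finset.sum_le_sum fun A _ => this A).trans ?_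
    rw [Finset.sum_add_distrib, ← Finset.sum_div]
    have := sum_truncated_column_le (N := N) (m := m) hc0 τ
    have := div_le_div_of_nonneg_right this hα0.le
    simp only [Finset.sum_const, Finset.card_univ, nsmul_eq_mul]
    simp
    rw [mul_add _ (2 * τ + α * ρ ^ 2), ← mul_div_assoc]
    exact add_le_add_right this _
  have hfin := le_of_mul_le_mul_left (hlow.trans (hmain.trans hup)) (by positivity)
  have hexp : N * (4 / c ^ 2 * Real.exp (m * (c ^ 2 / 2) - c * τ)) ≤ m ^ 2 / 64 := by
    have e1 : m * (c ^ 2 / 2) - c * τ = -(4 * L) := by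
      rw [hc]; field_simp; rw [hτ2]; ring
    have e2 : 4 / c ^ 2 = m / (2 * L) := by
      rw [hc, div_pow, hτ2]; field_simp; ring
    have e3 : Real.exp (-(4 * L)) ≤ Real.exp (-3) * Real.exp (-L) := by
      rw [← Real.exp_add]; apply Real.exp_le_exp.2; linarith
    have e4 : Real.exp (-3) * Real.exp (-1) ≤ 1 / 32 := by
      rw [← Real.exp_add, show (-3 + -1 : ℝ) = -(4 : ℕ) * 1 by norm_num, neg_mul,
        Real.exp_neg, Real.exp_nat_mul, ← one_div]
      apply one_div_le_one_div_of_le (by norm_num)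
      have := Real.exp_one_gt_d9
      calc (32:ℝ) ≤ 2.7 ^ 4 := by norm_num
        _ ≤ _ := by gcongr; linarith
    rw [e1, e2]
    calc _ ≤ N * (m / (2 * L) * (Real.exp (-3) * Real.exp (-L))) := by gcongr
      _ = m / (2 * L) * (Real.exp (-3) * (N * Real.exp (-L))) := by ring
      _ = m ^ 2 / (2 * L) * (Real.exp (-3) * Real.exp (-1)) := by rw [hexpL]; ring
      _ ≤ m ^ 2 / 2 * (1 / 32) := by gcongr; linarith
      _ = _ := by ring
  have h5 : N * (4 / c ^ 2 * Real.exp (m * (c ^ 2 / 2) - c * τ)) / α ≤ m * ρ / 8 := by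
    refine (div_le_div_of_nonneg_right hexp hα0.le).trans_eq ?_
    rw [hα]; field_simp; norm_num
  have h6 : α * ρ ^ 2 = m * ρ / 8 := by rw [hα]; field_simp
  have h7 : m * ρ ≤ 8 * τ := by linarith
  have h8 : (m * ρ) ^ 2 ≤ (8 * τ) ^ 2 := by gcongr
  rw [mul_pow, hρ2, mul_pow, hτ2] at h8
  have : (m : ℝ) ^ 2 * (32 ^ 2 * (L / m)) = 1024 * (m * L) := by field_simp; norm_num
  rw [this] at h8
  nlinarith [mul_pos hm0 (by linarith : 0 < L)]

end Kernel

section Norms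

variable {N : ℕ}

lemma pNorm_ofReal {p : ℝ} (hp : 0 ≤ p) (x : Fin N → ℝ) :
    pNorm (ENNReal.ofReal p) x = (∑ i, |x i| ^ p) ^ (1 / p) := by
  simp [pNorm, ENNReal.toReal_ofReal hp]

lemma pNorm_of_ne_top {q : ℝ≥0∞} (hq : q ≠ ∞) (x : Fin N → ℝ) :
    pNorm q x = (∑ i, |x i| ^ q.toReal) ^ (1 / q.toReal) := by
  simp [pNorm, hq]

lemma pNorm_top (x : Fin N → ℝ) : pNorm ∞ x = ⨆ i, |x i| := by
  simp [pNorm]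

lemma pNorm_nonneg (q : ℝ≥0∞) (x : Fin N → ℝ) : 0 ≤ pNorm q x := by
  unfold pNorm
  split_ifs
  · exact Real.iSup_nonneg fun _ => abs_nonneg _
  · positivity

lemma pNorm_smul {q : ℝ≥0∞} (hq : 0 < q) (c : ℝ) (x : Fin N → ℝ) :
    pNorm q (c • x) = |c| * pNorm q x := by
  by_cases h : q = ∞
  · subst h
    simp only [pNorm_top, Pi.smul_apply, smul_eq_mul, abs_mul]
    rw [Real.mul_iSup_of_nonneg (abs_nonneg c)]
  · have hq' : 0 < q.toReal := ENNReal.toReal_pos hq.ne' h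
    rw [pNorm_of_ne_top h, pNorm_of_ne_top h]
    simp only [Pi.smul_apply, smul_eq_mul, abs_mul]
    simp only [Real.mul_rpow (abs_nonneg c) (abs_nonneg _), ← Finset.mul_sum]
    rw [Real.mul_rpow (by positivity) (by positivity), ← Real.rpow_mul (abs_nonneg c),
      mul_one_div_cancel hq'.ne', Real.rpow_one]

lemma two_lt_toReal {q : ℝ≥0∞} (hq : 2 < q) (h : q ≠ ∞) : 2 < q.toReal := by
  have := (ENNReal.toReal_lt_toReal (by simp) h).2 hq
  simpa using this

lemma abs_le_sqrt_sum_sq (x : Fin N → ℝ) (i : Fin N) : |x i| ≤ √(∑ j, x j ^ 2) :=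
  Real.abs_le_sqrt (Finset.single_le_sum (f := fun j => x j ^ 2)
    (fun _ _ => sq_nonneg _) (Finset.mem_univ i))

lemma pNorm_le_sqrt_sum_sq {q : ℝ≥0∞} (hq : 2 < q) (x : Fin N → ℝ) :
    pNorm q x ≤ √(∑ j, x j ^ 2) := by
  by_cases h : q = ∞
  · subst h
    rw [pNorm_top]
    exact Real.iSup_le (abs_le_sqrt_sum_sq x) (Real.sqrt_nonneg _)
  · have h2 := two_lt_toReal hq h
    set r := q.toReal
    set R := √(∑ j, x j ^ 2) with hR
    have hR0 : 0 ≤ R := Real.sqrt_nonneg _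
    have hR2 : ∑ j, x j ^ 2 = R ^ 2 := (Real.sq_sqrt (by positivity)).symm
    rw [pNorm_of_ne_top h, one_div, Real.rpow_inv_le_iff_of_pos (by positivity) hR0 (by linarith)]
    have pt : ∀ t : ℝ, 0 ≤ t → t ^ r = t ^ (r - 2) * t ^ 2 := by
      intro t ht
      rw [← Real.rpow_natCast, ← Real.rpow_add_of_nonneg ht (by linarith) (by norm_num)]
      norm_num
    calc ∑ i, |x i| ^ r ≤ ∑ i, R ^ (r - 2) * x i ^ 2 := by
          refine Finset.sum_le_sum fun i _ => ?_
          rw [pt _ (abs_nonneg _), sq_abs]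
          gcongr
          exact abs_le_sqrt_sum_sq x i
      _ = R ^ r := by rw [← Finset.mul_sum, hR2, pt _ hR0]

lemma pNorm_ofReal_le_one_iff {p : ℝ} (hp : 0 < p) (x : Fin N → ℝ) :
    pNorm (ENNReal.ofReal p) x ≤ 1 ↔ ∑ i, |x i| ^ p ≤ 1 := by
  rw [pNorm_ofReal hp.le, one_div, Real.rpow_inv_le_iff_of_pos (by positivity) zero_le_one hp,
    Real.one_rpow]

lemma sum_sq_le_one {p : ℝ} (hp : 0 < p) (hp1 : p ≤ 1) {x : Fin N → ℝ}
    (hx : ∑ i, |x i| ^ p ≤ 1) : ∑ i, x i ^ 2 ≤ 1 := by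
  refine (Finset.sum_le_sum fun i _ => ?_).trans hx
  have h1 : |x i| ^ p ≤ 1 :=
    (Finset.single_le_sum (f := fun i => |x i| ^ p) (fun _ _ => by positivity)
      (Finset.mem_univ i)).trans hx
  have h2 : |x i| ≤ 1 := by
    by_contra! h
    exact absurd (Real.one_lt_rpow h hp) (by linarith)
  rw [← sq_abs, ← Real.rpow_natCast]
  rcases (abs_nonneg (x i)).eq_or_lt with h0 | h0
  · rw [← h0, Real.zero_rpow hp.ne', Real.zero_rpow (by norm_num)]
  · exact Real.rpow_le_rpow_of_exponent_ge h0 h2 (by norm_num; linarith)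

lemma pNorm_le_one {p : ℝ} (hp : 0 < p) (hp1 : p ≤ 1) {q : ℝ≥0∞} (hq : 2 < q) {x : Fin N → ℝ}
    (hx : pNorm (ENNReal.ofReal p) x ≤ 1) : pNorm q x ≤ 1 :=
  (pNorm_le_sqrt_sum_sq hq x).trans <| Real.sqrt_le_one.2 <|
    sum_sq_le_one hp hp1 ((pNorm_ofReal_le_one_iff hp x).1 hx)

/-- Interpolation of the `ℓ_1` norm between `ℓ_p` and `ℓ_2`. -/
lemma sum_abs_le_rpow_sum_sq {p : ℝ} (hp : 0 < p) (hp1 : p ≤ 1) {x : Fin N → ℝ}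
    (hx : ∑ i, |x i| ^ p ≤ 1) : ∑ i, |x i| ≤ (∑ i, x i ^ 2) ^ ((1 - p) / (2 - p)) := by
  rcases hp1.eq_or_lt with rfl | hlt
  · simpa using hx
  have h2p : 0 < 2 - p := by linarith
  have h1p : 0 < 1 - p := by linarith
  have hconj : (2 - p).HolderConjugate ((2 - p) / (1 - p)) := by
    rw [Real.holderConjugate_iff]
    refine ⟨by linarith, ?_⟩
    field_simp
    ring
  have hH := Real.inner_le_Lp_mul_Lq_of_nonneg Finset.univ hconj
    (f := fun i => |x i| ^ (p / (2 - p))) (g := fun i => |x i| ^ (2 * (1 - p) / (2 - p)))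
    (fun _ _ => by positivity) (fun _ _ => by positivity)
  have e1 : ∀ i, |x i| ^ (p / (2 - p)) * |x i| ^ (2 * (1 - p) / (2 - p)) = |x i| := by
    intro i
    rw [← Real.rpow_add_of_nonneg (abs_nonneg _) (by positivity) (by positivity)]
    have : p / (2 - p) + 2 * (1 - p) / (2 - p) = 1 := by field_simp; ring
    rw [this, Real.rpow_one]
  have e2 : ∀ i, (|x i| ^ (p / (2 - p))) ^ (2 - p) = |x i| ^ p := by
    intro i
    rw [← Real.rpow_mul (abs_nonneg _)]
    congr 1; field_simp
  have e3 : ∀ i, (|x i| ^ (2 * (1 - p) / (2 - p))) ^ ((2 - p) / (1 - p)) = x i ^ 2 := by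
    intro i
    rw [← Real.rpow_mul (abs_nonneg _), ← sq_abs, ← Real.rpow_natCast]
    congr 1; field_simp; norm_num
  simp only [e1, e2, e3] at hH
  refine hH.trans ?_
  rw [one_div_div]
  have : (∑ i, |x i| ^ p) ^ (1 / (2 - p)) ≤ 1 :=
    Real.rpow_le_one (by positivity) hx (by positivity)
  exact mul_le_of_le_one_left (by positivity) this

lemma sqrt_sum_sq_le_of_le_sum_abs {p : ℝ} (hp : 0 < p) (hp1 : p ≤ 1) {x : Fin N → ℝ}
    (hx : ∑ i, |x i| ^ p ≤ 1) {K : ℝ} (hK : 0 ≤ K)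
    (h : ∑ i, x i ^ 2 ≤ K * (∑ i, |x i|) ^ 2) : √(∑ i, x i ^ 2) ≤ K ^ (1 / p - 1 / 2) := by
  set S := ∑ i, x i ^ 2 with hS
  have h2p : 0 < 2 - p := by linarith
  have hS0 : 0 ≤ S := by positivity
  rcases hS0.eq_or_lt with h0 | h0
  · rw [← h0, Real.sqrt_zero]; positivity
  have h1 := sum_abs_le_rpow_sum_sq hp hp1 hx
  rw [← hS] at h1
  have h3 : S ≤ K * S ^ (2 * ((1 - p) / (2 - p))) := by
    refine h.trans ?_
    rw [mul_comm 2, Real.rpow_mul hS0]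
    norm_cast
    gcongr
  have h4 : S ^ (p / (2 - p)) ≤ K := by
    have e : S = S ^ (p / (2 - p)) * S ^ (2 * ((1 - p) / (2 - p))) := by
      rw [← Real.rpow_add h0]
      have : p / (2 - p) + 2 * ((1 - p) / (2 - p)) = 1 := by field_simp; ring
      rw [this, Real.rpow_one]
    refine le_of_mul_le_mul_right (a := S ^ (2 * ((1 - p) / (2 - p)))) ?_ (by positivity)
    rwa [← e]
  have h5 := Real.rpow_le_rpow (by positivity) h4 (z := 1 / p - 1 / 2)
    (by rw [sub_nonneg]; gcongr; linarith)
  rw [← Real.rpow_mul hS0] at h5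
  have : p / (2 - p) * (1 / p - 1 / 2) = 1 / 2 := by field_simp
  rwa [this, ← Real.sqrt_eq_rpow] at h5

end Norms

section Upper

lemma gelfandNumber_le {p q : ℝ≥0∞} {N n : ℕ} (M : Submodule ℝ (Fin N → ℝ))
    (hM : N - Module.finrank ℝ M < n) {B : ℝ} (hB : 0 ≤ B)
    (h : ∀ x ∈ M, pNorm p x ≤ 1 → pNorm q x ≤ B) : gelfandNumber p q N n ≤ B := by
  have hbdd : BddBelow { r : ℝ | ∃ M : Submodule ℝ (Fin N → ℝ), N - Module.finrank ℝ (↥M) < n ∧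
      r = sSup { s : ℝ | ∃ x ∈ M, pNorm p x ≤ 1 ∧ s = pNorm q x } } := by
    refine ⟨0, ?_⟩
    rintro r ⟨M', -, rfl⟩
    exact Real.sSup_nonneg (by rintro s ⟨x, -, -, rfl⟩; exact pNorm_nonneg q x)
  refine (csInf_le hbdd ⟨M, hM, rfl⟩).trans (Real.sSup_le ?_ hB)
  rintro s ⟨x, hx, hx1, rfl⟩
  exact h x hx hx1

lemma gelfandNumber_le_one {p : ℝ} (hp : 0 < p) (hp1 : p ≤ 1) {q : ℝ≥0∞} (hq : 2 < q) {N n : ℕ}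
    (hn : 1 ≤ n) : gelfandNumber (ENNReal.ofReal p) q N n ≤ 1 :=
  gelfandNumber_le ⊤ (by simp; omega) zero_le_one fun _ _ => pNorm_le_one hp hp1 hq

lemma gelfandNumber_le_rpow {p : ℝ} (hp : 0 < p) (hp1 : p ≤ 1) {q : ℝ≥0∞} (hq : 2 < q)
    {N m : ℕ} (hm : 1 ≤ m) (hmN : m ≤ N) :
    gelfandNumber (ENNReal.ofReal p) q N (m + 1) ≤
      (32 ^ 2 * ((Real.log (N / m) + 1) / m)) ^ (1 / p - 1 / 2) := by
  have hm0 : (0 : ℝ) < m := by exact_mod_cast hm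
  have hL : 0 ≤ Real.log (N / m) :=
    Real.log_nonneg (by rw [le_div_iff₀ hm0, one_mul]; exact_mod_cast hmN)
  obtain ⟨A, hA⟩ := exists_signMatrix_ker hm hmN
  let T : (Fin N → ℝ) →ₗ[ℝ] (Fin m → ℝ) :=
    Matrix.mulVecLin (Matrix.of fun i j => boolSign (A i j))
  have hT : ∀ x i, T x i = signForm (A i) x := fun x i => rfl
  refine gelfandNumber_le (LinearMap.ker T) ?_ (by positivity) fun x hx hx1 => ?_
  · have h1 := LinearMap.finrank_range_add_finrank_ker T
    have h2 := Submodule.finrank_le (LinearMap.range T)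
    simp only [Module.finrank_fin_fun] at h1 h2
    omega
  · refine (pNorm_le_sqrt_sum_sq hq x).trans ?_
    refine sqrt_sum_sq_le_of_le_sum_abs hp hp1 ((pNorm_ofReal_le_one_iff hp x).1 hx1)
      (by positivity) (hA x fun i => ?_)
    rw [← hT, LinearMap.mem_ker.1 hx, Pi.zero_apply]

theorem gelfandNumber_upper {p : ℝ} (hp : 0 < p) (hp1 : p ≤ 1) {q : ℝ≥0∞} (hq : 2 < q)
    {N m : ℕ} (hm : 1 ≤ m) (hmN : m ≤ N) :
    gelfandNumber (ENNReal.ofReal p) q N (m + 1) ≤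
      (32 ^ 2) ^ (1 / p - 1 / 2) *
        (min 1 ((Real.log (N / m) + 1) / m)) ^ (1 / p - 1 / 2) := by
  have hm0 : (0 : ℝ) < m := by exact_mod_cast hm
  have hL : 0 ≤ Real.log (N / m) :=
    Real.log_nonneg (by rw [le_div_iff₀ hm0, one_mul]; exact_mod_cast hmN)
  have he : 0 ≤ 1 / p - 1 / 2 := by rw [sub_nonneg]; gcongr; linarith
  rcases min_cases 1 ((Real.log (N / m) + 1) / m) with h | h <;> rw [h.1]
  · rw [Real.one_rpow, mul_one]
    exact (gelfandNumber_le_one hp hp1 hq (by omega)).trans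
      (Real.one_le_rpow (by norm_num) he)
  · rw [← Real.mul_rpow (by positivity) (by positivity)]
    exact gelfandNumber_le_rpow hp hp1 hq hm hmN

end Upper

section Code

/-- A Hamming ball of radius half the length is at most about the square root of the cube. -/
lemma card_hammingBall_le (s b : ℕ) (u : Fin s → Fin b) :
    (Finset.univ.filter fun w => 2 * hammingDist u w ≤ s).card ≤ 2 ^ s * b ^ (s / 2) := by
  classical
  have hsub : (Finset.univ.filter fun w => 2 * hammingDist u w ≤ s) ⊆
      (Finset.univ.filter fun T : Finset (Fin s) => 2 * T.card ≤ s).biUnion fun T =>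
        Fintype.piFinset fun i => if i ∈ T then Finset.univ else {u i} := by
    intro w hw
    simp only [Finset.mem_filter, Finset.mem_univ, true_and] at hw
    simp only [Finset.mem_biUnion, Finset.mem_filter, Finset.mem_univ, true_and,
      Fintype.mem_piFinset]
    refine ⟨Finset.univ.filter fun i => u i ≠ w i, hw, fun i => ?_⟩
    by_cases h : u i = w i <;> simp [h]
  refine (Finset.card_le_card hsub).trans (Finset.card_biUnion_le.trans ?_)
  have : ∀ T ∈ Finset.univ.filter fun T : Finset (Fin s) => 2 * T.card ≤ s,
      (Fintype.piFinset fun i => if i ∈ T then Finset.univ else {u i}).card ≤ b ^ (s / 2) := by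
    intro T hT
    simp only [Finset.mem_filter, Finset.mem_univ, true_and] at hT
    have e : (Fintype.piFinset fun i => if i ∈ T then Finset.univ else {u i}).card =
        b ^ T.card := by
      rw [Fintype.card_piFinset]
      have : ∀ i, (if i ∈ T then (Finset.univ : Finset (Fin b)) else {u i}).card =
          if i ∈ T then b else 1 := by
        intro i; split_ifs <;> simp
      simp [this]
    rw [e]
    rcases Nat.eq_zero_or_pos s with h0 | h0
    · subst h0
      have : T.card = 0 := by omega
      simp [this]
    · have : 0 < b := (u ⟨0, h0⟩).pos
      exact Nat.pow_le_pow_right this (by omega)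
  refine (Finset.sum_le_sum this).trans ?_
  rw [Finset.sum_const, smul_eq_mul]
  gcongr
  refine (Finset.card_filter_le _ _).trans ?_
  simp

/-- A Gilbert–Varshamov bound. -/
lemma exists_code (s b : ℕ) (hb : 0 < b) : ∃ U : Finset (Fin s → Fin b),
    (∀ u ∈ U, ∀ w ∈ U, u ≠ w → s < 2 * hammingDist u w) ∧ b ^ s ≤ U.card ^ 2 * 4 ^ s := by
  classical
  let Q : Finset (Fin s → Fin b) → Prop := fun U =>
    ∀ u ∈ U, ∀ w ∈ U, u ≠ w → s < 2 * hammingDist u w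
  obtain ⟨U, hU⟩ := (Set.toFinite {U | Q U}).exists_maximal ⟨∅, by simp [Q]⟩
  have hQ : Q U := hU.prop
  refine ⟨U, hQ, ?_⟩
  have hcov : (Finset.univ : Finset (Fin s → Fin b)) ⊆
      U.biUnion fun u => Finset.univ.filter fun w => 2 * hammingDist u w ≤ s := by
    intro w _
    simp only [Finset.mem_biUnion, Finset.mem_filter, Finset.mem_univ, true_and]
    by_contra! hw
    have hQ' : Q (insert w U) := by
      intro x hx y hy hxy
      rcases Finset.mem_insert.1 hx with hxw | hx' <;>
        rcases Finset.mem_insert.1 hy with hyw | hy'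
      · exact absurd (hxw.trans hyw.symm) hxy
      · rw [hxw, hammingDist_comm]; exact hw y hy'
      · rw [hyw]; exact hw x hx'
      · exact hQ x hx' y hy' hxy
    have : w ∈ U := hU.le_of_ge hQ' (Finset.subset_insert w U) (Finset.mem_insert_self w U)
    simpa using hw w this
  have h1 : b ^ s ≤ U.card * (2 ^ s * b ^ (s / 2)) := by
    calc b ^ s = (Finset.univ : Finset (Fin s → Fin b)).card := by simp
      _ ≤ _ := (Finset.card_le_card hcov).trans
        (Finset.card_biUnion_le_card_mul _ _ _ fun u _ => card_hammingBall_le s b u)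
  have h2 : b ^ (s / 2) * b ^ (s / 2) ≤ b ^ s := by
    rw [← pow_add]; exact Nat.pow_le_pow_right hb (by omega)
  have h3 : b ^ s * b ^ s ≤ (U.card ^ 2 * 4 ^ s) * b ^ s := by
    calc b ^ s * b ^ s ≤ (U.card * (2 ^ s * b ^ (s / 2))) * (U.card * (2 ^ s * b ^ (s / 2))) :=
          Nat.mul_le_mul h1 h1
      _ = (U.card ^ 2 * 4 ^ s) * (b ^ (s / 2) * b ^ (s / 2)) := by
          rw [show 4 = 2 * 2 by rfl, mul_pow]; ring
      _ ≤ _ := by gcongr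
  exact Nat.le_of_mul_le_mul_right h3 (by positivity)

/-- A large family of `s`-element sets with pairwise large symmetric differences. -/
lemma exists_separated_family {N s b : ℕ} (hb : 0 < b) (h : s * b ≤ N) :
    ∃ F : Finset (Finset (Fin N)), (∀ I ∈ F, I.card = s) ∧
      (∀ I ∈ F, ∀ J ∈ F, I ≠ J → s < (I \ J).card + (J \ I).card) ∧
      b ^ s ≤ F.card ^ 2 * 4 ^ s := by
  classical
  obtain ⟨U, hU, hcard⟩ := exists_code s b hb
  let e : Fin s × Fin b ↪ Fin N := finProdFinEquiv.toEmbedding.trans (Fin.castLEEmb h)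
  let g : (Fin s → Fin b) → Finset (Fin N) := fun w =>
    Finset.univ.image fun i => e (i, w i)
  have hinj : ∀ w : Fin s → Fin b, Function.Injective fun i => e (i, w i) := by
    intro w i j hij
    exact (Prod.ext_iff.1 (e.injective hij)).1
  have hdiff : ∀ u w, hammingDist u w ≤ (g u \ g w).card := by
    intro u w
    rw [hammingDist, ← Finset.card_image_of_injective _ (hinj u)]
    refine Finset.card_le_card fun j hj => ?_
    obtain ⟨i, hi, rfl⟩ := Finset.mem_image.1 hj
    simp only [Finset.mem_filter, Finset.mem_univ, true_and] at hi
    refine Finset.mem_sdiff.2 ⟨Finset.mem_image_of_mem _ (Finset.mem_univ i), fun hmem => ?_⟩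
    obtain ⟨k, -, hk⟩ := Finset.mem_image.1 hmem
    have hk' := e.injective hk
    obtain ⟨rfl, h2⟩ := Prod.ext_iff.1 hk'
    exact hi h2.symm
  have hsep : ∀ u ∈ U, ∀ w ∈ U, u ≠ w → s < (g u \ g w).card + (g w \ g u).card := by
    intro u hu w hw huw
    have h1 := hU u hu w hw huw
    have h2 := hdiff u w
    have h3 := hdiff w u
    rw [hammingDist_comm] at h3
    omega
  refine ⟨U.image g, ?_, ?_, ?_⟩
  · intro I hI
    obtain ⟨w, -, rfl⟩ := Finset.mem_image.1 hI
    simp only [g]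
    rw [Finset.card_image_of_injective _ (hinj w), Finset.card_univ, Fintype.card_fin]
  · intro I hI J hJ hIJ
    obtain ⟨u, hu, rfl⟩ := Finset.mem_image.1 hI
    obtain ⟨w, hw, rfl⟩ := Finset.mem_image.1 hJ
    exact hsep u hu w hw fun h => hIJ (h ▸ rfl)
  · rw [Finset.card_image_of_injOn]
    · exact hcard
    · intro u hu w hw huw
      by_contra hne
      have := hsep u hu w hw hne
      rw [show g u = g w from huw] at this
      simp at this

end Code

section Volume

open MeasureTheory
open scoped Pointwise

variable {N : ℕ}

lemma sum_abs_add_rpow_le {p : ℝ} (hp : 0 < p) (hp1 : p ≤ 1) (S : Finset (Fin N))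
    (x y : Fin N → ℝ) :
    ∑ i ∈ S, |x i + y i| ^ p ≤ ∑ i ∈ S, |x i| ^ p + ∑ i ∈ S, |y i| ^ p := by
  rw [← Finset.sum_add_distrib]
  refine Finset.sum_le_sum fun i _ => ?_
  calc |x i + y i| ^ p ≤ (|x i| + |y i|) ^ p := by gcongr; exact abs_add_le _ _
    _ ≤ _ := Real.rpow_add_le_add_rpow (abs_nonneg _) (abs_nonneg _) hp.le hp1

lemma isCompact_sum_abs_rpow_le {p : ℝ} (hp : 0 < p) (t : ℝ) :
    IsCompact {x : Fin N → ℝ | ∑ i, |x i| ^ p ≤ t} := by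
  refine Metric.isCompact_of_isClosed_isBounded ?_ ?_
  · exact isClosed_le (continuous_finsetSum _ fun i _ =>
      ((continuous_apply i).abs).rpow_const fun _ => Or.inr hp.le) continuous_const
  · rcases le_total 0 t with ht | ht
    · refine (Metric.isBounded_closedBall (x := (0 : Fin N → ℝ)) (r := t ^ (1 / p))).subset ?_
      intro x hx
      rw [mem_closedBall_zero_iff, pi_norm_le_iff_of_nonneg (by positivity)]
      intro i
      rw [Real.norm_eq_abs, one_div, Real.le_rpow_inv_iff_of_pos (abs_nonneg _) ht hp]
      exact (Finset.single_le_sum (f := fun i => |x i| ^ p) (fun _ _ => by positivity)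
        (Finset.mem_univ i)).trans hx
    · refine (Metric.isBounded_closedBall (x := (0 : Fin N → ℝ)) (r := 0)).subset ?_
      intro x hx
      rw [mem_closedBall_zero_iff, pi_norm_le_iff_of_nonneg le_rfl]
      intro i
      have h1 : |x i| ^ p ≤ 0 := ((Finset.single_le_sum (f := fun i => |x i| ^ p)
        (fun _ _ => by positivity) (Finset.mem_univ i)).trans hx).trans ht
      by_contra! h
      rw [Real.norm_eq_abs] at h
      exact absurd (Real.rpow_pos_of_pos h p) (not_lt.2 h1)

/-- The indicator vector of a set of indices. -/
def indVec (I : Finset (Fin N)) (i : Fin N) : ℝ := if i ∈ I then 1 else 0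

lemma sum_abs_indVec_rpow {p : ℝ} (hp : 0 < p) (I : Finset (Fin N)) :
    ∑ i, |indVec I i| ^ p = I.card := by
  have : ∀ i, |indVec I i| ^ p = if i ∈ I then 1 else 0 := by
    intro i; unfold indVec; split_ifs <;> simp [hp.ne']
  simp [this]

lemma card_sdiff_add_card_sdiff_le {p : ℝ} (hp : 0 < p) (I J : Finset (Fin N)) :
    ((I \ J).card + (J \ I).card : ℝ) ≤ ∑ i ∈ I ∪ J, |indVec I i - indVec J i| ^ p := by
  have : ∀ i, |indVec I i - indVec J i| ^ p =
      (if i ∈ I \ J then 1 else 0) + (if i ∈ J \ I then 1 else 0) := by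
    intro i
    by_cases h1 : i ∈ I <;> by_cases h2 : i ∈ J <;> simp [indVec, h1, h2, hp.ne']
  simp only [this, Finset.sum_add_distrib, Finset.sum_boole]
  apply le_of_eq
  congr 3
  · ext i; simp; tauto
  · ext i; simp; tauto

/-- A volumetric bound on separated families under a null space property. -/
lemma card_family_le {p : ℝ} (hp : 0 < p) (hp1 : p ≤ 1) {s : ℕ} (hs : 0 < s)
    (M : Submodule ℝ (Fin N → ℝ))
    (hM : ∀ v ∈ M, ∀ S : Finset (Fin N), S.card ≤ 2 * s →
      2 * ∑ i ∈ S, |v i| ^ p ≤ ∑ i, |v i| ^ p)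
    (F : Finset (Finset (Fin N))) (hF : ∀ I ∈ F, I.card = s)
    (hsep : ∀ I ∈ F, ∀ J ∈ F, I ≠ J → s < (I \ J).card + (J \ I).card) :
    (F.card : ℝ) ≤ ((3 : ℝ) ^ (1 / p)) ^ (N - Module.finrank ℝ M) := by
  set k := N - Module.finrank ℝ M with hk
  have hs0 : (0 : ℝ) < s := by exact_mod_cast hs
  obtain ⟨T, hTs, hTk⟩ : ∃ T : (Fin N → ℝ) →ₗ[ℝ] (Fin k → ℝ),
      Function.Surjective T ∧ LinearMap.ker T = M := by
    have h1 := Submodule.finrank_quotient_add_finrank M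
    rw [Module.finrank_fin_fun] at h1
    have h2 : Module.finrank ℝ ((Fin N → ℝ) ⧸ M) = Module.finrank ℝ (Fin k → ℝ) := by
      rw [Module.finrank_fin_fun]; omega
    let e := LinearEquiv.ofFinrankEq _ _ h2
    refine ⟨e.toLinearMap ∘ₗ M.mkQ, e.surjective.comp M.mkQ_surjective, ?_⟩
    rw [LinearEquiv.ker_comp, Submodule.ker_mkQ]
  have hTc : Continuous T := LinearMap.continuous_of_finiteDimensional T
  set B : Set (Fin N → ℝ) := {x | ∑ i, |x i| ^ p ≤ s / 2} with hB
  set V := T '' B with hV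
  have hVc : IsCompact V := (isCompact_sum_abs_rpow_le hp _).image hTc
  have hVpos : volume V ≠ 0 := by
    have hopen : IsOpen {x : Fin N → ℝ | ∑ i, |x i| ^ p < s / 2} :=
      isOpen_lt (continuous_finsetSum _ fun i _ =>
        ((continuous_apply i).abs).rpow_const fun _ => Or.inr hp.le) continuous_const
    have h1 : IsOpen (T '' {x : Fin N → ℝ | ∑ i, |x i| ^ p < s / 2}) :=
      (T.isOpenMap_of_finiteDimensional hTs) _ hopen
    have h2 : (T '' {x : Fin N → ℝ | ∑ i, |x i| ^ p < s / 2}).Nonempty :=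
      ⟨T 0, 0, by simp [Real.zero_rpow hp.ne', hs], rfl⟩
    have h3 := h1.measure_pos volume h2
    exact (h3.trans_le (measure_mono (Set.image_mono fun x
      (hx : ∑ i, |x i| ^ p < s / 2) => hx.le))).ne'
  have hVfin : volume V ≠ ⊤ := hVc.measure_lt_top.ne
  set W : Finset (Fin N) → Set (Fin k → ℝ) := fun I => T (indVec I) +ᵥ V with hW
  have hdisj : (F : Set (Finset (Fin N))).PairwiseDisjoint W := by
    intro I hI J hJ hIJ
    rw [Function.onFun, Set.disjoint_left]
    rintro _ ⟨_, ⟨a, ha, rfl⟩, rfl⟩ ⟨_, ⟨b, hb, rfl⟩, hab⟩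
    simp only [vadd_eq_add, ← map_add] at hab
    have hmem : indVec I + a - (indVec J + b) ∈ M := by
      rw [← hTk, LinearMap.mem_ker, map_sub, hab, sub_self]
    set v := indVec I + a - (indVec J + b) with hv
    set w := b - a with hw
    have hwP : ∑ i, |w i| ^ p ≤ s := by
      have := sum_abs_add_rpow_le hp hp1 Finset.univ b (-a)
      simp only [Pi.neg_apply, abs_neg, ← sub_eq_add_neg] at this
      have ha' : ∑ i, |a i| ^ p ≤ s / 2 := ha
      have hb' : ∑ i, |b i| ^ p ≤ s / 2 := hb
      simp only [hw, Pi.sub_apply]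
      linarith
    have hS : (I ∪ J).card ≤ 2 * s := by
      refine (Finset.card_union_le I J).trans ?_
      rw [hF I hI, hF J hJ]; omega
    have h1 := hM v hmem (I ∪ J) hS
    have h2 := Finset.sum_add_sum_compl (I ∪ J) fun i => |v i| ^ p
    have h3 := Finset.sum_add_sum_compl (I ∪ J) fun i => |w i| ^ p
    have h4 : ∑ i ∈ (I ∪ J)ᶜ, |v i| ^ p = ∑ i ∈ (I ∪ J)ᶜ, |w i| ^ p := by
      refine Finset.sum_congr rfl fun i hi => ?_
      simp only [Finset.mem_compl, Finset.mem_union, not_or] at hi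
      simp only [hv, hw, Pi.sub_apply, Pi.add_apply, indVec, hi.1, hi.2, if_false, zero_add]
      rw [abs_sub_comm]
    have h5 := sum_abs_add_rpow_le hp hp1 (I ∪ J) v w
    have h6 : ∀ i, v i + w i = indVec I i - indVec J i := by
      intro i; simp only [hv, hw, Pi.sub_apply, Pi.add_apply]; ring
    simp only [h6] at h5
    have h7 := card_sdiff_add_card_sdiff_le hp I J
    have h8 : (s : ℝ) < (I \ J).card + (J \ I).card := by
      exact_mod_cast hsep I hI J hJ hIJ
    linarith
  set c : ℝ := (3 : ℝ) ^ (1 / p) with hc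
  have hc0 : 0 < c := by positivity
  have hcp : c ^ p = 3 := by
    rw [hc, ← Real.rpow_mul (by norm_num), one_div_mul_cancel hp.ne', Real.rpow_one]
  have hsub : (⋃ I ∈ F, W I) ⊆ c • V := by
    refine Set.iUnion₂_subset fun I hI => ?_
    rintro _ ⟨_, ⟨a, ha, rfl⟩, rfl⟩
    rw [Set.mem_smul_set_iff_inv_smul_mem₀ hc0.ne']
    refine ⟨c⁻¹ • (indVec I + a), ?_, by simp [vadd_eq_add]⟩
    have h1 := sum_abs_add_rpow_le hp hp1 Finset.univ (indVec I) a
    rw [sum_abs_indVec_rpow hp, hF I hI] at h1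
    have ha' : ∑ i, |a i| ^ p ≤ s / 2 := ha
    have h2 : ∑ i, |(c⁻¹ • (indVec I + a)) i| ^ p = (∑ i, |indVec I i + a i| ^ p) / 3 := by
      rw [Finset.sum_div]
      refine Finset.sum_congr rfl fun i _ => ?_
      rw [Pi.smul_apply, smul_eq_mul, abs_mul, Real.mul_rpow (abs_nonneg _) (abs_nonneg _),
        abs_of_pos (inv_pos.2 hc0), Real.inv_rpow hc0.le, hcp, Pi.add_apply]
      ring
    rw [hB, Set.mem_ofPred_eq, h2]
    linarith
  have hvol : (F.card : ℝ≥0∞) * volume V ≤ ENNReal.ofReal (c ^ k) * volume V := by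
    calc (F.card : ℝ≥0∞) * volume V = ∑ I ∈ F, volume (W I) := by
          simp [hW, measure_vadd]
      _ = volume (⋃ I ∈ F, W I) := by
          refine (measure_biUnion_finset hdisj fun I _ => ?_).symm
          exact (hVc.vadd _).measurableSet
      _ ≤ volume (c • V) := measure_mono hsub
      _ = _ := by
          rw [Measure.addHaar_smul, Module.finrank_fin_fun, abs_of_pos (by positivity)]
  have hfin := (ENNReal.mul_le_mul_iff_left hVpos hVfin).1 hvol
  rw [← ENNReal.ofReal_natCast] at hfin
  exact (ENNReal.ofReal_le_ofReal_iff (by positivity)).1 hfin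

end Volume

section Lower

variable {N : ℕ}

lemma one_div_toReal_le {q : ℝ≥0∞} (hq : 2 < q) : 1 / q.toReal ≤ 1 / 2 := by
  by_cases h : q = ∞
  · simp [h]
  · have := two_lt_toReal hq h
    gcongr

/-- Hölder's inequality on a set of coordinates. -/
lemma sum_rpow_le_card_rpow_mul {p : ℝ} (hp : 0 < p) (hp1 : p ≤ 1) {q : ℝ≥0∞} (hq : 2 < q)
    (S : Finset (Fin N)) (x : Fin N → ℝ) :
    ∑ i ∈ S, |x i| ^ p ≤ (S.card : ℝ) ^ (p * (1 / p - 1 / q.toReal)) * pNorm q x ^ p := by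
  by_cases h : q = ∞
  · subst h
    have e : p * (1 / p - 1 / ENNReal.toReal ∞) = 1 := by simp [hp.ne']
    rw [e, Real.rpow_one, ← nsmul_eq_mul]
    refine Finset.sum_le_card_nsmul _ _ _ fun i _ => ?_
    have : |x i| ≤ pNorm ∞ x := by
      rw [pNorm_top]
      exact le_ciSup (f := fun i => |x i|) (Set.finite_range _).bddAbove i
    gcongr
  · have h2 := two_lt_toReal hq h
    set r := q.toReal
    have hr0 : 0 < r := by linarith
    have hr : 1 ≤ r / p := by rw [le_div_iff₀ hp]; linarith
    have h1 := Real.rpow_sum_le_const_mul_sum_rpow_of_nonneg S hr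
      (f := fun i => |x i| ^ p) (fun i _ => by positivity)
    have e1 : ∀ i, (|x i| ^ p) ^ (r / p) = |x i| ^ r := by
      intro i
      rw [← Real.rpow_mul (abs_nonneg _), mul_div_cancel₀ _ hp.ne']
    simp only [e1] at h1
    have h3 := Real.rpow_le_rpow (by positivity) h1 (z := p / r) (by positivity)
    rw [← Real.rpow_mul (by positivity), Real.mul_rpow (by positivity) (by positivity),
      ← Real.rpow_mul (by positivity)] at h3
    have e2 : r / p * (p / r) = 1 := by field_simp
    have e3 : (r / p - 1) * (p / r) = p * (1 / p - 1 / r) := by field_simp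
    rw [e2, Real.rpow_one, e3] at h3
    refine h3.trans ?_
    rw [pNorm_of_ne_top h, ← Real.rpow_mul (by positivity), one_div_mul_eq_div]
    gcongr
    exact Finset.subset_univ S

lemma pNorm_rpow_le_of_section {p : ℝ} (hp : 0 < p) {q : ℝ≥0∞} (hq : 0 < q)
    (M : Submodule ℝ (Fin N → ℝ)) {r : ℝ} (hr : 0 ≤ r)
    (h : ∀ x ∈ M, pNorm (ENNReal.ofReal p) x ≤ 1 → pNorm q x ≤ r) {x : Fin N → ℝ} (hx : x ∈ M) :
    pNorm q x ^ p ≤ r ^ p * ∑ i, |x i| ^ p := by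
  have hp' : 0 < ENNReal.ofReal p := ENNReal.ofReal_pos.2 hp
  set P := ∑ i, |x i| ^ p with hP
  have hP0 : 0 ≤ P := by positivity
  rcases hP0.eq_or_lt with h0 | h0
  · have hx0 : x = 0 := by
      ext i
      have := (Finset.sum_eq_zero_iff_of_nonneg (fun i _ => by positivity)).1 h0.symm i
        (Finset.mem_univ i)
      rw [Real.rpow_eq_zero (abs_nonneg _) hp.ne'] at this
      simpa using this
    have : pNorm q x = 0 := by
      rw [hx0]; simpa using pNorm_smul hq 0 (0 : Fin N → ℝ)
    rw [this, Real.zero_rpow hp.ne']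
    positivity
  · set t := P ^ (1 / p) with ht
    have ht0 : 0 < t := by positivity
    have htP : pNorm (ENNReal.ofReal p) x = t := pNorm_ofReal hp.le x
    have h1 := h (t⁻¹ • x) (M.smul_mem _ hx) (by
      rw [pNorm_smul hp', htP, abs_of_pos (by positivity), inv_mul_cancel₀ ht0.ne'])
    rw [pNorm_smul hq, abs_of_pos (by positivity), inv_mul_le_iff₀ ht0] at h1
    calc pNorm q x ^ p ≤ (t * r) ^ p := by
          have := pNorm_nonneg q x
          gcongr
      _ = r ^ p * P := by
          rw [Real.mul_rpow ht0.le hr, ht, ← Real.rpow_mul hP0, one_div_mul_cancel hp.ne',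
            Real.rpow_one, mul_comm]

/-- A null space property of order `2 s` forces the codimension to be large. -/
lemma mul_log_le_of_nullSpace {p : ℝ} (hp : 0 < p) (hp1 : p ≤ 1) {s b m : ℕ} (hs : 0 < s)
    (hb : 0 < b) (hsb : s * b ≤ N) (M : Submodule ℝ (Fin N → ℝ))
    (hMm : N - Module.finrank ℝ M ≤ m)
    (hM : ∀ v ∈ M, ∀ S : Finset (Fin N), S.card ≤ 2 * s →
      2 * ∑ i ∈ S, |v i| ^ p ≤ ∑ i, |v i| ^ p) :
    s * Real.log (b / 4) ≤ 2 * m / p * Real.log 3 := by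
  obtain ⟨F, hF, hsep, hcard⟩ := exists_separated_family hb hsb
  have h1 := card_family_le hp hp1 hs M hM F hF hsep
  have h2 : (F.card : ℝ) ≤ ((3 : ℝ) ^ (1 / p)) ^ m :=
    h1.trans (pow_le_pow_right₀ (Real.one_le_rpow (by norm_num) (by positivity)) hMm)
  have hcard' : (b : ℝ) ^ s ≤ (F.card : ℝ) ^ 2 * 4 ^ s := by exact_mod_cast hcard
  have h3 : ((b : ℝ) / 4) ^ s ≤ (((3 : ℝ) ^ (1 / p)) ^ m) ^ 2 := by
    rw [div_pow, div_le_iff₀ (by positivity)]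
    refine hcard'.trans ?_
    gcongr
  have hb' : (0 : ℝ) < b := by exact_mod_cast hb
  have h4 := Real.log_le_log (by positivity) h3
  rw [Real.log_pow, Real.log_pow, Real.log_pow, Real.log_rpow (by norm_num)] at h4
  refine h4.trans_eq ?_
  push_cast
  ring

/-- The section bound, in terms of a test dimension `t`. -/
lemma rpow_le_of_one_le {p e r t μ D : ℝ} (hp : 0 < p) (he : 0 ≤ e) (hr : 0 ≤ r)
    (ht : 0 < t) (hμ : 0 ≤ μ) (hD : 0 < D) (htμ : t * μ ≤ D)
    (h : 1 ≤ 2 * t ^ (p * e) * r ^ p) :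
    (1 / 2) ^ (1 / p) * (1 / D) ^ e * μ ^ e ≤ r := by
  have h1 : (1 / 2 : ℝ) ≤ (t ^ e * r) ^ p := by
    rw [Real.mul_rpow (by positivity) hr, ← Real.rpow_mul ht.le, mul_comm e p]
    linarith
  have h2 : (1 / 2 : ℝ) ^ (1 / p) ≤ t ^ e * r := by
    rw [one_div p, Real.rpow_inv_le_iff_of_pos (by positivity) (by positivity) hp]
    exact h1
  calc (1 / 2) ^ (1 / p) * (1 / D) ^ e * μ ^ e ≤ (t ^ e * r) * (1 / D) ^ e * μ ^ e := by gcongr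
    _ = (t * (1 / D) * μ) ^ e * r := by
        rw [Real.mul_rpow (by positivity) hμ, Real.mul_rpow ht.le (by positivity)]; ring
    _ ≤ 1 * r := by
        gcongr
        refine Real.rpow_le_one (by positivity) ?_ he
        rw [mul_one_div, div_mul_eq_mul_div, div_le_one hD]
        exact htμ
    _ = r := one_mul r

lemma one_le_of_exists_ne_zero {p : ℝ} (hp : 0 < p) (hp1 : p ≤ 1) {q : ℝ≥0∞} (hq : 2 < q)
    (M : Submodule ℝ (Fin N → ℝ)) (hMne : M ≠ ⊥) {r : ℝ} (hr : 0 ≤ r)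
    (h : ∀ x ∈ M, pNorm (ENNReal.ofReal p) x ≤ 1 → pNorm q x ≤ r) :
    1 ≤ 2 * (N : ℝ) ^ (p * (1 / p - 1 / q.toReal)) * r ^ p := by
  obtain ⟨x, hx, hx0⟩ := Submodule.exists_mem_ne_zero_of_ne_bot hMne
  have h1 := sum_rpow_le_card_rpow_mul hp hp1 hq Finset.univ x
  have h2 := pNorm_rpow_le_of_section hp (by positivity : 0 < q) M hr h hx
  rw [Finset.card_univ, Fintype.card_fin] at h1
  set P := ∑ i, |x i| ^ p with hP
  have hP0 : 0 < P := by
    obtain ⟨i, hi⟩ := Function.ne_iff.1 hx0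
    have : 0 < |x i| := abs_pos.2 hi
    exact Finset.sum_pos' (fun i _ => by positivity) ⟨i, Finset.mem_univ i, by positivity⟩
  set w := (N : ℝ) ^ (p * (1 / p - 1 / q.toReal))
  have hw : 0 ≤ w := by positivity
  have h3 : 1 * P ≤ (w * r ^ p) * P := by
    rw [one_mul, mul_assoc]
    exact h1.trans (by gcongr)
  have h4 := le_of_mul_le_mul_right h3 hP0
  linarith

lemma nullSpace_of_lt_one {p : ℝ} (hp : 0 < p) (hp1 : p ≤ 1) {q : ℝ≥0∞} (hq : 2 < q)
    (M : Submodule ℝ (Fin N → ℝ)) {r : ℝ} (hr : 0 ≤ r)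
    (h : ∀ x ∈ M, pNorm (ENNReal.ofReal p) x ≤ 1 → pNorm q x ≤ r) {s : ℕ}
    (hlt : 2 * (2 * s : ℝ) ^ (p * (1 / p - 1 / q.toReal)) * r ^ p < 1) :
    ∀ v ∈ M, ∀ S : Finset (Fin N), S.card ≤ 2 * s →
      2 * ∑ i ∈ S, |v i| ^ p ≤ ∑ i, |v i| ^ p := by
  intro v hv S hS
  have he : 0 ≤ 1 / p - 1 / q.toReal := by
    have : 1 ≤ 1 / p := by rw [le_div_iff₀ hp]; linarith
    linarith [one_div_toReal_le hq]
  have h1 := sum_rpow_le_card_rpow_mul hp hp1 hq S v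
  have h2 := pNorm_rpow_le_of_section hp (by positivity : 0 < q) M hr h hv
  have hS' : (S.card : ℝ) ≤ 2 * s := by exact_mod_cast hS
  have hP : 0 ≤ ∑ i, |v i| ^ p := by positivity
  have h3 : ∑ i ∈ S, |v i| ^ p ≤
      (2 * s : ℝ) ^ (p * (1 / p - 1 / q.toReal)) * (r ^ p * ∑ i, |v i| ^ p) := by
    refine h1.trans ?_
    have := Real.rpow_nonneg (pNorm_nonneg q v) p
    gcongr
  nlinarith

/-- The lower bound for the radius of a section of codimension at most `m`. -/
lemma le_radius_of_section {p : ℝ} (hp : 0 < p) (hp1 : p ≤ 1) {q : ℝ≥0∞} (hq : 2 < q) {m : ℕ}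
    (hm : 1 ≤ m) (hmN : m < N) (M : Submodule ℝ (Fin N → ℝ))
    (hMm : N - Module.finrank ℝ M ≤ m) {r : ℝ} (hr : 0 ≤ r)
    (h : ∀ x ∈ M, pNorm (ENNReal.ofReal p) x ≤ 1 → pNorm q x ≤ r) :
    (1 / 2) ^ (1 / p) * (1 / (768 * (20 / p) ^ 2) ^ 2) ^ (1 / p - 1 / q.toReal) *
      (min 1 ((Real.log (N / m) + 1) / m)) ^ (1 / p - 1 / q.toReal) ≤ r := by
  have he : 0 ≤ 1 / p - 1 / q.toReal := by
    have : 1 ≤ 1 / p := by rw [le_div_iff₀ hp]; linarith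
    linarith [one_div_toReal_le hq]
  have hm1 : (1 : ℝ) ≤ m := by exact_mod_cast hm
  have hm0 : (0 : ℝ) < m := by linarith
  have hN0 : (0 : ℝ) < N := by exact_mod_cast (by omega : 0 < N)
  set K := 20 / p with hK
  have hK1 : 20 ≤ K := by rw [hK, le_div_iff₀ hp]; nlinarith
  set D := 768 * K ^ 2 with hD
  have hD1 : 768 * 20 ≤ D := by rw [hD]; nlinarith
  have hy1 : 1 ≤ (N : ℝ) / m := by
    rw [le_div_iff₀ hm0, one_mul]; exact_mod_cast hmN.le
  set L := Real.log (N / m) + 1 with hL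
  have hL1 : 1 ≤ L := by linarith [Real.log_nonneg hy1]
  have hLy : L ≤ N / m := by
    have := Real.log_le_sub_one_of_pos (by linarith : 0 < (N : ℝ) / m)
    linarith
  set μ := min 1 (L / m) with hμ
  have hμ0 : 0 ≤ μ := le_min zero_le_one (by positivity)
  have hμ1 : μ ≤ 1 := min_le_left _ _
  have hμ2 : μ ≤ L / m := min_le_right _ _
  by_cases hcase : (N : ℝ) < D * m
  · have hne : M ≠ ⊥ := by
      rintro rfl
      simp at hMm
      omega
    refine rpow_le_of_one_le hp he hr hN0 hμ0 (by positivity) ?_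
      (one_le_of_exists_ne_zero hp hp1 hq M hne hr h)
    have h1 : (N : ℝ) / m ≤ D := by rw [div_le_iff₀ hm0]; exact hcase.le
    calc N * μ ≤ N * (L / m) := by gcongr
      _ = (N / m) * L := by ring
      _ ≤ D * D := by gcongr; exact hLy.trans h1
      _ = D ^ 2 := by ring
  · push Not at hcase
    set s := ⌈K * m / L⌉₊ with hs
    have hKm : 0 < K * m / L := by positivity
    have hs0 : 0 < s := Nat.ceil_pos.2 hKm
    have hs0' : (0 : ℝ) < s := by exact_mod_cast hs0
    have hs1 : K * m / L ≤ s := Nat.le_ceil _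
    have hs2 : (s : ℝ) < K * m / L + 1 := Nat.ceil_lt_add_one hKm.le
    have hs3 : (s : ℝ) ≤ 2 * K * m := by
      have : K * m / L ≤ K * m := div_le_self (by positivity) hL1
      nlinarith
    refine rpow_le_of_one_le hp he hr (t := 2 * s) (by positivity) hμ0 (by positivity) ?_ ?_
    · have h1 : K * m / L * μ ≤ K := by
        calc K * m / L * μ ≤ K * m / L * (L / m) := by gcongr
          _ = K := by field_simp
      have h2 : s * μ ≤ (K * m / L + 1) * μ := by gcongr
      have h3 : (2 * s) * μ ≤ 2 * K + 2 := by nlinarith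
      refine h3.trans ?_
      nlinarith
    · by_contra! hlt
      have hns := nullSpace_of_lt_one hp hp1 hq M hr h hlt
      set b := N / s with hb
      have hbig : 4 * (s : ℝ) ≤ N := by nlinarith [mul_pos hm0 (by linarith : 0 < K)]
      have hb1 : (N : ℝ) / s < b + 1 := by
        rw [div_lt_iff₀ hs0']
        have := Nat.lt_mul_div_succ N hs0
        have h' : N < (b + 1) * s := by rw [mul_comm]; exact this
        exact_mod_cast h'
      have hb2 : (N : ℝ) / (2 * s) ≤ b := by
        have h2 : 2 ≤ (N : ℝ) / s := by rw [le_div_iff₀ hs0']; linarith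
        have h3 : (N : ℝ) / (2 * s) = N / s / 2 := by field_simp
        linarith
      have hb0 : (0 : ℝ) < b := lt_of_lt_of_le (by positivity) hb2
      have hmain := mul_log_le_of_nullSpace hp hp1 hs0 (by exact_mod_cast hb0)
        (Nat.mul_div_le N s) M hMm hns
      have hlog : L / 2 ≤ Real.log (b / 4) := by
        have h1 : (N / m : ℝ) / (16 * K) ≤ b / 4 := by
          calc (N / m : ℝ) / (16 * K) = N / (2 * (2 * K * m)) / 4 := by field_simp; norm_num
            _ ≤ N / (2 * s) / 4 := by gcongr
            _ ≤ b / 4 := by gcongr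
        have h2 : Real.exp 1 * (N / m) ≤ (b / 4) ^ 2 := by
          have hyD : D ≤ (N : ℝ) / m := by rw [le_div_iff₀ hm0]; exact hcase
          have he3 : Real.exp 1 ≤ 3 := by linarith [Real.exp_one_lt_d9]
          calc Real.exp 1 * (N / m) ≤ 3 * (N / m) := by gcongr
            _ = D / (256 * K ^ 2) * (N / m) := by rw [hD]; field_simp; norm_num
            _ ≤ (N / m) / (256 * K ^ 2) * (N / m) := by gcongr
            _ = ((N / m : ℝ) / (16 * K)) ^ 2 := by field_simp; norm_num
            _ ≤ _ := by gcongr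
        have h3 := Real.log_le_log (by positivity) h2
        rw [Real.log_mul (by positivity) (by positivity), Real.log_exp, Real.log_pow] at h3
        push_cast at h3
        linarith
      have h4 : K * m ≤ s * L := by rwa [div_le_iff₀ (by positivity)] at hs1
      have h5 : s * (L / 2) ≤ s * Real.log (b / 4) := by gcongr
      have h6 : Real.log 3 ≤ 2 := by
        have := Real.log_le_sub_one_of_pos (by norm_num : (0 : ℝ) < 3)
        linarith
      have h7 : 2 * m / p * Real.log 3 ≤ 2 * m / p * 2 := by gcongr
      have h8 : 2 * m / p * 2 = K * m / 5 := by rw [hK]; field_simp; norm_num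
      have h9 : 0 < K * m := by positivity
      linarith

theorem gelfandNumber_lower {p : ℝ} (hp : 0 < p) (hp1 : p ≤ 1) {q : ℝ≥0∞} (hq : 2 < q) {m : ℕ}
    (hm : 1 ≤ m) (hmN : m < N) :
    (1 / 2) ^ (1 / p) * (1 / (768 * (20 / p) ^ 2) ^ 2) ^ (1 / p - 1 / q.toReal) *
      (min 1 ((Real.log (N / m) + 1) / m)) ^ (1 / p - 1 / q.toReal) ≤
      gelfandNumber (ENNReal.ofReal p) q N (m + 1) := by
  have hne : { r : ℝ | ∃ M : Submodule ℝ (Fin N → ℝ), N - Module.finrank ℝ (↥M) < m + 1 ∧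
      r = sSup { s : ℝ | ∃ x ∈ M, pNorm (ENNReal.ofReal p) x ≤ 1 ∧ s = pNorm q x } }.Nonempty :=
    ⟨_, ⊤, by simp, rfl⟩
  refine le_csInf hne ?_
  rintro r ⟨M, hM, rfl⟩
  refine le_radius_of_section hp hp1 hq hm hmN M (by omega)
    (Real.sSup_nonneg (by rintro s ⟨x, -, -, rfl⟩; exact pNorm_nonneg q x)) fun x hx hx1 => ?_
  refine le_csSup ⟨1, ?_⟩ ⟨x, hx, hx1, rfl⟩
  rintro s ⟨x, -, hx1, rfl⟩
  exact pNorm_le_one hp hp1 hq hx1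

end Lower

end GelfandWidth

/-- For `0 < p₁ ≤ 1` and `2 < p₂ ≤ ∞` there are constants `C₁, C₂ > 0`, depending
only on `p₁` and `p₂`, such that for all `2 ≤ n ≤ N`,
`C₁·min{1,(ln(N/(n-1))+1)/(n-1)}^{1/p₁-1/p₂} ≤ c_n(id : ℓ_{p₁}^N → ℓ_{p₂}^N)
≤ C₂·min{1,(ln(N/(n-1))+1)/(n-1)}^{1/p₁-1/2}`. -/
theorem gelfand_two_sided_large_p2 (p₁ : ℝ) (p₂ : ℝ≥0∞) (h1 : 0 < p₁) (h2 : p₁ ≤ 1)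
    (h3 : 2 < p₂) :
    ∃ C₁ C₂ : ℝ, 0 < C₁ ∧ 0 < C₂ ∧ ∀ N n : ℕ, 2 ≤ n → n ≤ N →
      C₁ * (min 1 ((Real.log ((N : ℝ) / ((n : ℝ) - 1)) + 1) / ((n : ℝ) - 1)))
            ^ (1/p₁ - 1/p₂.toReal) ≤
          gelfandNumber (ENNReal.ofReal p₁) p₂ N n ∧
      gelfandNumber (ENNReal.ofReal p₁) p₂ N n ≤
        C₂ * (min 1 ((Real.log ((N : ℝ) / ((n : ℝ) - 1)) + 1) / ((n : ℝ) - 1)))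
            ^ (1/p₁ - 1/2) := by
  refine ⟨(1 / 2) ^ (1 / p₁) * (1 / (768 * (20 / p₁) ^ 2) ^ 2) ^ (1 / p₁ - 1 / p₂.toReal),
    (32 ^ 2) ^ (1 / p₁ - 1 / 2), by positivity, by positivity, fun N n hn hnN => ?_⟩
  obtain ⟨m, rfl⟩ : ∃ m, n = m + 1 := ⟨n - 1, by omega⟩
  have hm : ((m + 1 : ℕ) : ℝ) - 1 = m := by push_cast; ring
  rw [hm]
  exact ⟨GelfandWidth.gelfandNumber_lower h1 h2 h3 (by omega) (by omega),
    GelfandWidth.gelfandNumber_upper h1 h2 h3 (by omega) (by omega)⟩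
end
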